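/- For every positive integer r and every real c < 1/(2 ln 2) there exists an integer M such that for every integer m ≥ M (with m > r) both H(m+r, m) ≥ c·m·ln m and H(m−r, m) ≥ c·m·ln m hold; that is, liminf_{m→∞} H(m±r, m)/(m·ln m) ≥ 1/(2 ln 2). -/

import Mathlib

open Filter Polynomial

/-- `Γ` is a periodic orbit of the planar vector field `V`: the image of a
nonconstant periodic solution of `γ' = V ∘ γ`. -/
def IsPeriodicOrbit (V : ℝ × ℝ → ℝ × ℝ) (Γ : Set (ℝ × ℝ)) : Prop :=
  ∃ γ : ℝ → ℝ × ℝ,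
    (∀ t : ℝ, HasDerivAt γ (V (γ t)) t) ∧
    (∃ T : ℝ, 0 < T ∧ Function.Periodic γ T) ∧
    (∃ t₁ t₂ : ℝ, γ t₁ ≠ γ t₂) ∧
    Γ = Set.range γ

/-- `Γ` is a limit cycle of `V`: a periodic orbit which is isolated among
periodic orbits. -/
def IsLimitCycle (V : ℝ × ℝ → ℝ × ℝ) (Γ : Set (ℝ × ℝ)) : Prop :=
  IsPeriodicOrbit V Γ ∧
  ∃ U : Set (ℝ × ℝ), IsOpen U ∧ Γ ⊆ U ∧
    ∀ Γ' : Set (ℝ × ℝ), IsPeriodicOrbit V Γ' → Γ' ⊆ U → Γ' = Γ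

/-- The Liénard vector field `ẋ = y, ẏ = -g(x) - ε f(x) y`. -/
def lienard (f g : Polynomial ℝ) (ε : ℝ) : ℝ × ℝ → ℝ × ℝ :=
  fun p => (p.2, -(g.eval p.1) - ε * (f.eval p.1) * p.2)

/-- `HGe n m c` formalizes `H(n,m) ≥ c`: there are polynomials `f, g` with
`deg f ≤ n`, `deg g ≤ m` and `ε₀ > 0` such that for every `0 < ε ≤ ε₀` the
Liénard system has at least `c` pairwise distinct limit cycles. -/
def HGe (n m : ℕ) (c : ℝ) : Prop :=
  ∃ f g : Polynomial ℝ, f.natDegree ≤ n ∧ g.natDegree ≤ m ∧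
    ∃ ε₀ : ℝ, 0 < ε₀ ∧ ∀ ε : ℝ, 0 < ε → ε ≤ ε₀ →
      ∃ S : Finset (Set (ℝ × ℝ)),
        (∀ Γ ∈ S, IsLimitCycle (lienard f g ε) Γ) ∧ c ≤ (S.card : ℝ)

open Set Topology MeasureTheory

/-- Solutions of a bounded, globally Lipschitz scalar equation on `[0, T]`, depending continuously
on the initial value. -/
lemma exists_scalar_flow {v : ℝ → ℝ → ℝ} {x₀ T : ℝ} {r L K : NNReal} (hT : 0 ≤ T)
    (hlip : ∀ t ∈ Icc 0 T, LipschitzWith K (v t))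
    (hcont : ∀ x, ContinuousOn (fun t => v t x) (Icc 0 T))
    (hbound : ∀ t ∈ Icc 0 T, ∀ x, |v t x| ≤ L) :
    ∃ α : ℝ → ℝ → ℝ,
      (∀ x ∈ Metric.closedBall x₀ r, α x 0 = x ∧
        (∀ t ∈ Icc 0 T, HasDerivWithinAt (α x) (v t (α x t)) (Icc 0 T) t) ∧
        ∀ t ∈ Icc 0 T, |α x t - x| ≤ L * T) ∧
      ContinuousOn (fun x => α x T) (Metric.closedBall x₀ r) := by
  have hpl : IsPicardLindelof v (tmin := 0) (tmax := T) ⟨0, left_mem_Icc.2 hT⟩ x₀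
      (r + L * ⟨T, hT⟩) r L K := by
    refine ⟨fun t ht => (hlip t ht).lipschitzOnWith, fun x _ => hcont x,
      fun t ht x _ => hbound t ht x, ?_⟩
    have : max (T - 0) (0 - 0 : ℝ) = T := by simp [hT]
    simp only [this]
    simp only [NNReal.coe_add, add_sub_cancel_left]
    exact (NNReal.coe_mul L ⟨T, hT⟩).ge
  obtain ⟨α, hα, L', hL'⟩ :=
    hpl.exists_forall_mem_closedBall_eq_hasDerivWithinAt_lipschitzOnWith
  refine ⟨α, fun x hx => ⟨(hα x hx).1, (hα x hx).2, fun t ht => ?_⟩,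
    (hL' T (right_mem_Icc.2 hT)).continuousOn⟩
  have := Convex.norm_image_sub_le_of_norm_hasDerivWithin_le (hα x hx).2
    (fun t ht => hbound t ht _) (convex_Icc 0 T) (left_mem_Icc.2 hT) ht
  have h0 : α x 0 = x := (hα x hx).1
  rw [h0] at this
  refine this.trans ?_
  rw [sub_zero, Real.norm_eq_abs, abs_of_nonneg ht.1]
  exact mul_le_mul_of_nonneg_left ht.2 L.2

/-- A solution on `[0, T]` of a `T`-periodic equation with equal end values extends to a periodic
solution. -/
lemma exists_periodic_extension {v : ℝ → ℝ → ℝ} {T : ℝ} (hT : 0 < T)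
    (hv : ∀ t x, v (t + T) x = v t x) {S : ℝ → ℝ} (hS : S T = S 0)
    (hder : ∀ t ∈ Icc 0 T, HasDerivWithinAt S (v t (S t)) (Icc 0 T) t) :
    ∃ p : ℝ → ℝ, Function.Periodic p T ∧ (∀ t ∈ Icc 0 T, p t = S t) ∧
      ∀ t, HasDerivAt p (v t (p t)) t := by
  have hper : Function.Periodic (fun t => S (toIcoMod hT 0 t)) T := fun t => by
    simp [toIcoMod_add_right]
  set p : ℝ → ℝ := fun t => S (toIcoMod hT 0 t) with hp
  have hpS : ∀ t ∈ Icc 0 T, p t = S t := by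
    intro t ht
    rcases eq_or_lt_of_le ht.2 with h | h
    · subst h
      simp only [hp]
      rw [hS]
      congr 1
      simpa using toIcoMod_apply_right hT (0 : ℝ)
    · simp only [hp]
      rw [(toIcoMod_eq_self hT).2 ⟨ht.1, by simpa using h⟩]
  have hvper : ∀ x, Function.Periodic (fun t => v t x) T := fun x t => hv t x
  have hderp : ∀ t ∈ Icc 0 T, HasDerivWithinAt p (v t (p t)) (Icc 0 T) t := by
    intro t ht
    rw [hpS t ht]
    exact (hder t ht).congr (fun s hs => hpS s hs) (hpS t ht)
  have hleft : HasDerivWithinAt p (v 0 (p 0)) (Iic 0) 0 := by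
    have h1 : HasDerivWithinAt p (v T (p T)) (Iic T) T :=
      (hderp T (right_mem_Icc.2 hT.le)).mono_of_mem_nhdsWithin (Icc_mem_nhdsLE hT)
    have h2 : HasDerivWithinAt (fun s : ℝ => s + T) 1 (Iic 0) 0 :=
      ((hasDerivAt_id (0 : ℝ)).add_const T).hasDerivWithinAt
    have h3 := HasDerivWithinAt.scomp (t' := Iic T) 0 (by simpa using h1) h2
      (fun s hs => by simpa using hs)
    have e1 : v T (p T) = v 0 (p 0) := by
      have := hper 0
      have h' := hv 0 (p 0)
      simp only [zero_add] at this h'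
      rw [this, h']
    have e2 : (p ∘ fun s : ℝ => s + T) = p := funext hper
    rw [e2, one_smul] at h3
    simpa [e1] using h3
  have hbase : ∀ t ∈ Ico 0 T, HasDerivAt p (v t (p t)) t := by
    intro t ht
    rcases eq_or_lt_of_le ht.1 with h | h
    · subst h
      have h1 : HasDerivWithinAt p (v 0 (p 0)) (Ici 0) 0 :=
        (hderp 0 (left_mem_Icc.2 hT.le)).mono_of_mem_nhdsWithin (Icc_mem_nhdsGE hT)
      have := hleft.union h1
      rwa [Iic_union_Ici, hasDerivWithinAt_univ] at this
    · exact (hderp t ⟨ht.1, ht.2.le⟩).hasDerivAt (Icc_mem_nhds h ht.2)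
  refine ⟨p, hper, hpS, fun t => ?_⟩
  have hmem : toIcoMod hT 0 t ∈ Ico 0 T := by simpa using toIcoMod_mem_Ico hT 0 t
  have h1 := hbase _ hmem
  set k := toIcoDiv hT 0 t with hk
  have ht : toIcoMod hT 0 t = t - k • T := rfl
  rw [ht] at h1
  have h2 := h1.comp_sub_const t (k • T)
  have e1 : (fun s => p (s - k • T)) = p := funext fun s => hper.sub_zsmul_eq k
  have e2 : p (t - k • T) = p t := hper.sub_zsmul_eq k
  have e3 : v (t - k • T) (p t) = v t (p t) := (hvper (p t)).sub_zsmul_eq k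
  rwa [e1, e2, e3] at h2

/-- Uniform estimates for a `2π`-periodic field which is `C¹` near `{0} × ℝ × {ρ₀}`. -/
lemma averaging_estimates {R : ℝ × ℝ × ℝ → ℝ} {ρ₀ : ℝ} {m : ℝ → ℝ}
    (hper : ∀ ε ψ ρ, R (ε, ψ + 2 * Real.pi, ρ) = R (ε, ψ, ρ))
    (hR : ∀ ψ, ContDiffAt ℝ 1 R (0, ψ, ρ₀))
    (hm : ∀ ψ, HasDerivAt (fun ρ => R (0, ψ, ρ)) (m ψ) ρ₀)
    {c : ℝ} (hc : 0 < c) {V : Set ℝ} (hV : V ∈ 𝓝 ρ₀) :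
    Continuous m ∧ Function.Periodic m (2 * Real.pi) ∧
    ∃ η > 0, Metric.closedBall ρ₀ η ⊆ V ∧ ∃ C > 0, 
      (∀ᶠ ε in 𝓝 (0 : ℝ),
        (∀ ψ, ∀ ρ ∈ Metric.closedBall ρ₀ η, |R (ε, ψ, ρ)| ≤ C) ∧
        (∀ ρ ∈ Metric.closedBall ρ₀ η,
          ContinuousOn (fun ψ => R (ε, ψ, ρ)) (Icc 0 (2 * Real.pi))) ∧
        (∀ ψ, ∀ ρ ∈ Metric.closedBall ρ₀ η, ∀ ρ' ∈ Metric.closedBall ρ₀ η,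
          |R (ε, ψ, ρ) - R (ε, ψ, ρ') - m ψ * (ρ - ρ')| ≤ c * |ρ - ρ'|)) ∧
      ∀ d > 0, ∀ᶠ ε in 𝓝 (0 : ℝ), ∀ ψ ∈ Icc 0 (2 * Real.pi),
        |R (ε, ψ, ρ₀) - R (0, ψ, ρ₀)| ≤ d := by
  have hπ : (0 : ℝ) < 2 * Real.pi := by positivity
  have hline : ∀ ε ψ ρ, DifferentiableAt ℝ R (ε, ψ, ρ) →
      HasDerivAt (fun ρ => R (ε, ψ, ρ)) (fderiv ℝ R (ε, ψ, ρ) (0, 0, 1)) ρ := by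
    intro ε ψ ρ h
    have h1 : HasDerivAt (fun ρ : ℝ => (ε, ψ, ρ)) ((0, 0, 1) : ℝ × ℝ × ℝ) ρ :=
      (hasDerivAt_const ρ ε).prodMk ((hasDerivAt_const ρ ψ).prodMk (hasDerivAt_id ρ))
    exact h.hasFDerivAt.comp_hasDerivAt ρ h1
  have hmf : m = fun ψ => fderiv ℝ R (0, ψ, ρ₀) (0, 0, 1) := by
    funext ψ
    exact (hm ψ).unique (hline 0 ψ ρ₀ ((hR ψ).differentiableAt one_ne_zero))
  have hfd : ∀ ψ, ContinuousAt (fun q => fderiv ℝ R q (0, 0, 1)) (0, ψ, ρ₀) := fun ψ =>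
    ((hR ψ).continuousAt_fderiv one_ne_zero).clm_apply continuousAt_const
  have hmc : Continuous m := by
    rw [hmf, continuous_iff_continuousAt]
    intro ψ
    exact ContinuousAt.comp (f := fun ψ : ℝ => ((0 : ℝ), ψ, ρ₀)) (hfd ψ) (by fun_prop)
  have hmp : Function.Periodic m (2 * Real.pi) := by
    intro ψ
    have := hm (ψ + 2 * Real.pi)
    simp only [hper] at this
    exact this.unique (hm ψ)
  refine ⟨hmc, hmp, ?_⟩
  have hRc : Continuous fun ψ => R (0, ψ, ρ₀) := by
    rw [continuous_iff_continuousAt]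
    intro ψ
    exact ContinuousAt.comp (f := fun ψ : ℝ => ((0 : ℝ), ψ, ρ₀)) (hR ψ).continuousAt (by fun_prop)
  obtain ⟨C₀, hC₀⟩ := isCompact_Icc.exists_bound_of_continuousOn
    (hRc.continuousOn (s := Icc 0 (2 * Real.pi)))
  set C := max C₀ 0 + 1 with hC
  have hCpos : 0 < C := by positivity
  have hswap : ∀ ψ : ℝ, Tendsto (fun z : (ℝ × ℝ) × ℝ => (z.1.1, z.2, z.1.2))
      (𝓝 (((0 : ℝ), ρ₀), ψ)) (𝓝 (0, ψ, ρ₀)) := fun ψ => by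
    have : Continuous (fun z : (ℝ × ℝ) × ℝ => (z.1.1, z.2, z.1.2)) := by fun_prop
    exact this.tendsto _
  have key : ∀ᶠ q : ℝ × ℝ in 𝓝 ((0 : ℝ), ρ₀), ∀ ψ ∈ Icc 0 (2 * Real.pi),
      ContDiffAt ℝ 1 R (q.1, ψ, q.2) ∧ |R (q.1, ψ, q.2)| ≤ C ∧
        |fderiv ℝ R (q.1, ψ, q.2) (0, 0, 1) - m ψ| ≤ c := by
    refine isCompact_Icc.eventually_forall_of_forall_eventually
      (P := fun (q : ℝ × ℝ) ψ => ContDiffAt ℝ 1 R (q.1, ψ, q.2) ∧ |R (q.1, ψ, q.2)| ≤ C ∧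
        |fderiv ℝ R (q.1, ψ, q.2) (0, 0, 1) - m ψ| ≤ c) fun ψ hψ => ?_
    refine ((hswap ψ).eventually ((hR ψ).eventually (by simp))).and (.and ?_ ?_)
    · have h1 := ((hR ψ).continuousAt.abs).tendsto.comp (hswap ψ)
      have h2 : |R (0, ψ, ρ₀)| < C := by
        have := hC₀ ψ hψ
        rw [Real.norm_eq_abs] at this
        have := le_max_left C₀ 0
        linarith
      exact (h1.eventually (gt_mem_nhds h2)).mono fun z hz => hz.le
    · have h1 := (hfd ψ).tendsto.comp (hswap ψ)
      have h2 : Tendsto (fun z : (ℝ × ℝ) × ℝ => m z.2) (𝓝 (((0 : ℝ), ρ₀), ψ)) (𝓝 (m ψ)) :=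
        (hmc.comp continuous_snd).tendsto _
      have h3 := (h1.sub h2).abs
      have h4 : |fderiv ℝ R (0, ψ, ρ₀) (0, 0, 1) - m ψ| < c := by
        rw [hmf]; simpa using hc
      exact (h3.eventually (gt_mem_nhds h4)).mono fun z hz => hz.le
  have hred : ∀ (ψ : ℝ), ∃ ψ' ∈ Icc 0 (2 * Real.pi), m ψ = m ψ' ∧
      ∀ ε ρ, R (ε, ψ, ρ) = R (ε, ψ', ρ) := by
    intro ψ
    refine ⟨toIcoMod hπ 0 ψ, ?_, ?_, fun ε ρ => ?_⟩
    · have := toIcoMod_mem_Ico hπ 0 ψ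
      rw [zero_add] at this
      exact Ico_subset_Icc_self this
    · exact (hmp.sub_zsmul_eq _).symm
    · have : Function.Periodic (fun ψ => R (ε, ψ, ρ)) (2 * Real.pi) := fun ψ => hper ε ψ ρ
      exact (this.sub_zsmul_eq _).symm
  have hunif : ∀ d > 0, ∀ᶠ ε in 𝓝 (0 : ℝ), ∀ ψ ∈ Icc 0 (2 * Real.pi),
        |R (ε, ψ, ρ₀) - R (0, ψ, ρ₀)| ≤ d := by
    intro d hd
    refine isCompact_Icc.eventually_forall_of_forall_eventually
      (P := fun (ε : ℝ) ψ => |R (ε, ψ, ρ₀) - R (0, ψ, ρ₀)| ≤ d) fun ψ hψ => ?_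
    have h0 : Tendsto (fun z : ℝ × ℝ => (z.1, z.2, ρ₀)) (𝓝 ((0 : ℝ), ψ)) (𝓝 (0, ψ, ρ₀)) := by
      have : Continuous (fun z : ℝ × ℝ => (z.1, z.2, ρ₀)) := by fun_prop
      exact this.tendsto _
    have h1 := (hR ψ).continuousAt.tendsto.comp h0
    have h2 : Tendsto (fun z : ℝ × ℝ => R (0, z.2, ρ₀)) (𝓝 ((0 : ℝ), ψ)) (𝓝 (R (0, ψ, ρ₀))) :=
      (hRc.comp continuous_snd).tendsto _
    have h3 := (h1.sub h2).abs
    have h4 : |R (0, ψ, ρ₀) - R (0, ψ, ρ₀)| < d := by simpa using hd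
    exact (h3.eventually (gt_mem_nhds h4)).mono fun z hz => hz.le
  rw [nhds_prod_eq] at key
  obtain ⟨pa, hpa, pb, hpb, hab⟩ := eventually_prod_iff.1 key
  obtain ⟨η, hη, hball⟩ := Metric.nhds_basis_closedBall.mem_iff.1 (inter_mem hpb hV)
  refine ⟨η, hη, fun x hx => (hball hx).2, C, hCpos, ?_, hunif⟩
  filter_upwards [hpa] with ε hε
  have H : ∀ ψ ∈ Icc 0 (2 * Real.pi), ∀ ρ ∈ Metric.closedBall ρ₀ η, _ :=
    fun ψ hψ ρ hρ => hab hε (hball hρ).1 ψ hψ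
  refine ⟨fun ψ ρ hρ => ?_, fun ρ hρ ψ hψ => ?_, fun ψ ρ hρ ρ' hρ' => ?_⟩
  · obtain ⟨ψ', hψ', -, h2⟩ := hred ψ
    rw [h2]
    exact (H ψ' hψ' ρ hρ).2.1
  · have := (H ψ hψ ρ hρ).1.continuousAt
    exact (ContinuousAt.comp (f := fun ψ : ℝ => (ε, ψ, ρ)) this (by fun_prop)).continuousWithinAt
  · obtain ⟨ψ', hψ', h1, h2⟩ := hred ψ
    rw [h1, h2, h2]
    have := Convex.norm_image_sub_le_of_norm_hasDerivWithin_le (C := c)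
      (f := fun ρ => R (ε, ψ', ρ) - m ψ' * ρ)
      (f' := fun ρ => fderiv ℝ R (ε, ψ', ρ) (0, 0, 1) - m ψ')
      (s := Metric.closedBall ρ₀ η) (x := ρ') (y := ρ)
      (fun r hr => by
        have h3 := hline ε ψ' r ((H ψ' hψ' r hr).1.differentiableAt one_ne_zero)
        have h4 := (hasDerivAt_id r).const_mul (m ψ')
        simp only [mul_one] at h4
        exact (h3.sub h4).hasDerivWithinAt)
      (fun r hr => (H ψ' hψ' r hr).2.2) (convex_closedBall _ _) hρ' hρ
    simp only [Real.norm_eq_abs] at this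
    convert this using 2
    ring

/-- First order averaging: a simple zero `ρ₀` of the averaged field yields, for small `ε > 0`, a
periodic solution near `ρ₀`, and no other closed trajectory stays near `ρ₀`. -/
lemma exists_isolated_periodic_solution {R : ℝ × ℝ × ℝ → ℝ} {ρ₀ : ℝ} {m : ℝ → ℝ}
    (hper : ∀ ε ψ ρ, R (ε, ψ + 2 * Real.pi, ρ) = R (ε, ψ, ρ))
    (hR : ∀ ψ, ContDiffAt ℝ 1 R (0, ψ, ρ₀))
    (hm : ∀ ψ, HasDerivAt (fun ρ => R (0, ψ, ρ)) (m ψ) ρ₀)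
    (h0 : ∫ ψ in 0..2 * Real.pi, R (0, ψ, ρ₀) = 0) (h1 : ∫ ψ in 0..2 * Real.pi, m ψ ≠ 0)
    {V : Set ℝ} (hV : V ∈ 𝓝 ρ₀) :
    ∃ η > 0, Metric.closedBall ρ₀ η ⊆ V ∧ ∀ᶠ ε in 𝓝[>] (0 : ℝ), ∃ p : ℝ → ℝ,
      Function.Periodic p (2 * Real.pi) ∧ (∀ ψ, p ψ ∈ Metric.ball ρ₀ η) ∧
      (∀ ψ, HasDerivAt p (ε * R (ε, ψ, p ψ)) ψ) ∧
      ∀ (ψ ρ ω : ℝ → ℝ) (T : ℝ) (k : ℕ), 0 < k → 0 ≤ T → (∀ t, HasDerivAt ψ (ω t) t) →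
        (∀ t, 0 < ω t) → (∀ t, HasDerivAt ρ (ω t * (ε * R (ε, ψ t, ρ t))) t) →
        (∀ t, ρ t ∈ Metric.ball ρ₀ η) → ρ T = ρ 0 → ψ T = ψ 0 + k * (2 * Real.pi) →
        ρ 0 = p (ψ 0) := by
  have hπ : (0 : ℝ) < 2 * Real.pi := by positivity
  obtain ⟨σ, hσ, hσm⟩ : ∃ σ : ℝ, (σ = 1 ∨ σ = -1) ∧ 0 < σ * ∫ ψ in 0..2 * Real.pi, m ψ := by
    rcases lt_or_gt_of_ne h1 with h | h
    · exact ⟨-1, Or.inr rfl, by linarith⟩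
    · exact ⟨1, Or.inl rfl, by linarith⟩
  have hσabs : |σ| = 1 := by rcases hσ with h | h <;> simp [h]
  have hσσ : σ * σ = 1 := by rcases hσ with h | h <;> simp [h]
  set κ := σ * ∫ ψ in 0..2 * Real.pi, m ψ with hκ
  set c := κ / (16 * Real.pi) with hc
  have hcpos : 0 < c := by positivity
  obtain ⟨hmc, hmp, η, hη, hηV, C, hC, hest, hunif⟩ := averaging_estimates hper hR hm hcpos hV
  obtain ⟨B, hB⟩ := isCompact_Icc.exists_bound_of_continuousOn
    (hmc.continuousOn (s := Icc 0 (2 * Real.pi)))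
  have hB0 : 0 ≤ B := (norm_nonneg _).trans (hB 0 (left_mem_Icc.2 hπ.le))
  refine ⟨η, hη, hηV, ?_⟩
  have hsmall : ∀ a b : ℝ, 0 < b → ∀ᶠ ε in 𝓝[>] (0 : ℝ), a * ε ≤ b := by
    intro a b hb
    have : Tendsto (fun ε : ℝ => a * ε) (𝓝 0) (𝓝 (a * 0)) := (continuous_const_mul a).tendsto 0
    rw [mul_zero] at this
    exact ((this.eventually (gt_mem_nhds hb)).filter_mono nhdsWithin_le_nhds).mono
      fun _ h => h.le
  filter_upwards [hest.filter_mono nhdsWithin_le_nhds,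
    (hunif (κ * η / (32 * Real.pi)) (by positivity)).filter_mono nhdsWithin_le_nhds,
    self_mem_nhdsWithin, hsmall (C * (2 * Real.pi)) (η / 4) (by positivity),
    hsmall (B * (C * (2 * Real.pi)) * (2 * Real.pi)) (κ * η / 16) (by positivity)]
    with ε ⟨hbd, hct, hlip⟩ hd hε hε1 hε2
  have hεpos : 0 < ε := hε
  have hsub : Icc (ρ₀ - η) (ρ₀ + η) = Metric.closedBall ρ₀ η := Real.closedBall_eq_Icc.symm
  have hle : ρ₀ - η ≤ ρ₀ + η := by linarith
  set pr : ℝ → ℝ := fun x => (projIcc (ρ₀ - η) (ρ₀ + η) hle x : ℝ) with hpr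
  have hprm : ∀ x, pr x ∈ Metric.closedBall ρ₀ η := fun x => by
    rw [← hsub]; exact (projIcc (ρ₀ - η) (ρ₀ + η) hle x).2
  have hpre : ∀ x ∈ Metric.closedBall ρ₀ η, pr x = x := fun x hx => by
    rw [← hsub] at hx
    simp only [hpr, projIcc_of_mem hle hx]
  have hprl : ∀ x y, |pr x - pr y| ≤ |x - y| := fun x y => by
    have := (LipschitzWith.projIcc hle).dist_le_mul x y
    rw [NNReal.coe_one, one_mul] at this
    exact this
  set v : ℝ → ℝ → ℝ := fun t x => ε * R (ε, t, pr x) with hv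
  have hvlip : ∀ t ∈ Icc 0 (2 * Real.pi), LipschitzWith (Real.toNNReal (ε * (B + c))) (v t) := by
    intro t ht
    refine LipschitzWith.of_dist_le_mul fun x y => ?_
    rw [Real.coe_toNNReal _ (by positivity), Real.dist_eq, Real.dist_eq, hv]
    have e1 := hlip t _ (hprm x) _ (hprm y)
    have e2 : |m t * (pr x - pr y)| ≤ B * |pr x - pr y| := by
      rw [abs_mul]
      exact mul_le_mul_of_nonneg_right (hB t ht) (abs_nonneg _)
    have e3 : |R (ε, t, pr x) - R (ε, t, pr y)| ≤ (B + c) * |pr x - pr y| := by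
      have := abs_add_le (R (ε, t, pr x) - R (ε, t, pr y) - m t * (pr x - pr y))
        (m t * (pr x - pr y))
      rw [sub_add_cancel] at this
      linarith
    have e4 : (B + c) * |pr x - pr y| ≤ (B + c) * |x - y| :=
      mul_le_mul_of_nonneg_left (hprl x y) (by positivity)
    simp only [← mul_sub, abs_mul, abs_of_pos hεpos]
    rw [mul_assoc]
    exact mul_le_mul_of_nonneg_left (e3.trans e4) hεpos.le
  have hvbd : ∀ t, ∀ x, |v t x| ≤ ε * C := fun t x => by
    simp only [hv, abs_mul, abs_of_pos hεpos]
    exact mul_le_mul_of_nonneg_left (hbd t _ (hprm x)) hεpos.le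
  obtain ⟨α, hα, hαc⟩ := exists_scalar_flow (v := v) (x₀ := ρ₀) (T := 2 * Real.pi)
    (r := Real.toNNReal (η / 2)) (L := Real.toNNReal (ε * C)) hπ.le hvlip
    (fun x => (hct _ (hprm x)).const_smul ε)
    (fun t _ x => by rw [Real.coe_toNNReal _ (by positivity)]; exact hvbd t x)
  rw [Real.coe_toNNReal _ (by positivity)] at hαc
  simp only [Real.coe_toNNReal _ (show 0 ≤ η / 2 by positivity),
    Real.coe_toNNReal _ (show 0 ≤ ε * C by positivity)] at hα
  have hαnear : ∀ x ∈ Metric.closedBall ρ₀ (η / 2), ∀ t ∈ Icc 0 (2 * Real.pi),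
      |α x t - x| ≤ C * (2 * Real.pi) * ε ∧ |α x t - ρ₀| ≤ 3 * η / 4 := by
    intro x hx t ht
    have e1 := (hα x hx).2.2 t ht
    have e2 : |x - ρ₀| ≤ η / 2 := hx
    have e3 := abs_add_le (α x t - x) (x - ρ₀)
    rw [sub_add_sub_cancel] at e3
    constructor
    · linarith
    · linarith
  have hαmem : ∀ x ∈ Metric.closedBall ρ₀ (η / 2), ∀ t ∈ Icc 0 (2 * Real.pi),
      α x t ∈ Metric.closedBall ρ₀ η := fun x hx t ht => by
    have := (hαnear x hx t ht).2
    rw [Metric.mem_closedBall, Real.dist_eq]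
    linarith
  have hdisp : ∀ x ∈ Metric.closedBall ρ₀ (η / 2),
      |α x (2 * Real.pi) - x - ε * ((x - ρ₀) * ∫ ψ in 0..2 * Real.pi, m ψ)| ≤
        ε * (κ * η / 4) := by
    intro x hx
    have hRc : Continuous fun ψ => R (0, ψ, ρ₀) := by
      rw [continuous_iff_continuousAt]
      intro ψ
      exact ContinuousAt.comp (f := fun ψ : ℝ => ((0 : ℝ), ψ, ρ₀)) (hR ψ).continuousAt
        (by fun_prop)
    have hder : ∀ t ∈ Icc 0 (2 * Real.pi), HasDerivWithinAt
        (fun t => α x t - ε * ((∫ ψ in 0..t, R (0, ψ, ρ₀)) + (x - ρ₀) * ∫ ψ in 0..t, m ψ))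
        (v t (α x t) - ε * (R (0, t, ρ₀) + (x - ρ₀) * m t)) (Icc 0 (2 * Real.pi)) t := by
      intro t ht
      have d1 : HasDerivAt (fun t => ∫ ψ in 0..t, R (0, ψ, ρ₀)) (R (0, t, ρ₀)) t :=
        intervalIntegral.integral_hasDerivAt_right (hRc.intervalIntegrable _ _)
          (hRc.stronglyMeasurableAtFilter _ _) hRc.continuousAt
      have d2 : HasDerivAt (fun t => ∫ ψ in 0..t, m ψ) (m t) t :=
        intervalIntegral.integral_hasDerivAt_right (hmc.intervalIntegrable _ _)
          (hmc.stronglyMeasurableAtFilter _ _) hmc.continuousAt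
      exact ((hα x hx).2.1 t ht).sub
        ((d1.add (d2.const_mul (x - ρ₀))).const_mul ε).hasDerivWithinAt
    have hbound : ∀ t ∈ Icc 0 (2 * Real.pi),
        ‖v t (α x t) - ε * (R (0, t, ρ₀) + (x - ρ₀) * m t)‖ ≤
          ε * (κ * η / (8 * Real.pi)) := by
      intro t ht
      have hmem := hαmem x hx t ht
      simp only [hv, hpre _ hmem]
      rw [← mul_sub, norm_mul, Real.norm_eq_abs, Real.norm_eq_abs, abs_of_pos hεpos]
      refine mul_le_mul_of_nonneg_left ?_ hεpos.le
      have e1 := hlip t _ hmem ρ₀ (Metric.mem_closedBall_self hη.le)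
      have e2 := hd t ht
      obtain ⟨e3, e4⟩ := hαnear x hx t ht
      have e5 : |m t * (α x t - x)| ≤ B * (C * (2 * Real.pi) * ε) := by
        rw [abs_mul]
        exact mul_le_mul (hB t ht) e3 (abs_nonneg _) hB0
      have e6 : B * (C * (2 * Real.pi) * ε) ≤ κ * η / (32 * Real.pi) := by
        rw [le_div_iff₀ (by positivity)]
        linarith
      have e7 : c * |α x t - ρ₀| ≤ c * η := mul_le_mul_of_nonneg_left (by linarith) hcpos.le
      have e8 : c * η = 2 * (κ * η / (32 * Real.pi)) := by
        rw [hc]; field_simp; norm_num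
      have e9 : κ * η / (8 * Real.pi) = 4 * (κ * η / (32 * Real.pi)) := by
        field_simp; norm_num
      rw [abs_le] at e1 e2 e5 ⊢
      constructor <;> linarith [e1.1, e1.2, e2.1, e2.2, e5.1, e5.2]
    have := Convex.norm_image_sub_le_of_norm_hasDerivWithin_le hder hbound (convex_Icc _ _)
      (left_mem_Icc.2 hπ.le) (right_mem_Icc.2 hπ.le)
    simp only [intervalIntegral.integral_same, h0, (hα x hx).1] at this
    have e : ε * (κ * η / 4) = ε * (κ * η / (8 * Real.pi)) * ‖2 * Real.pi - 0‖ := by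
      rw [sub_zero, Real.norm_of_nonneg hπ.le]; field_simp; norm_num
    rw [e]
    refine le_trans (le_of_eq ?_) this
    rw [Real.norm_eq_abs]
    congr 1
    ring
  have hball2 : Icc (ρ₀ - η / 2) (ρ₀ + η / 2) = Metric.closedBall ρ₀ (η / 2) :=
    Real.closedBall_eq_Icc.symm
  obtain ⟨x, hx, hfix⟩ : ∃ x ∈ Metric.closedBall ρ₀ (η / 2), α x (2 * Real.pi) = x := by
    have hcont : ContinuousOn (fun x => σ * (α x (2 * Real.pi) - x))
        (Icc (ρ₀ - η / 2) (ρ₀ + η / 2)) := by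
      rw [hball2]
      exact continuousOn_const.mul (hαc.sub continuousOn_id)
    have hiv := intermediate_value_Icc (by linarith) hcont
    have hpos : 0 < ε * (κ * η) := by positivity
    have e1 := hdisp (ρ₀ - η / 2) (by rw [← hball2]; exact left_mem_Icc.2 (by linarith))
    have e2 := hdisp (ρ₀ + η / 2) (by rw [← hball2]; exact right_mem_Icc.2 (by linarith))
    have key : ∀ d s : ℝ, |d - ε * (s * ∫ ψ in 0..2 * Real.pi, m ψ)| ≤ ε * (κ * η / 4) →
        |σ * d - ε * (s * κ)| ≤ ε * (κ * η / 4) := by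
      intro d s h
      have : σ * d - ε * (s * κ) = σ * (d - ε * (s * ∫ ψ in 0..2 * Real.pi, m ψ)) := by
        rw [hκ]; ring
      rw [this, abs_mul, hσabs, one_mul]
      exact h
    have e1' := abs_le.1 (key _ _ e1)
    have e2' := abs_le.1 (key _ _ e2)
    obtain ⟨x, hx, hx0⟩ := hiv (show (0 : ℝ) ∈ _ from
      ⟨by nlinarith [e1'.2], by nlinarith [e2'.1]⟩)
    refine ⟨x, hball2 ▸ hx, ?_⟩
    have hσ0 : σ ≠ 0 := by rintro rfl; simp at hσabs
    have := (mul_eq_zero.1 hx0).resolve_left hσ0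
    linarith
  obtain ⟨p, hpp, hpS, hpd⟩ := exists_periodic_extension (v := v) (S := α x) hπ
    (fun t y => by simp only [hv, hper]) (by rw [hfix, (hα x hx).1]) (hα x hx).2.1
  have hpmem : ∀ ψ, p ψ ∈ Metric.ball ρ₀ η := by
    intro ψ
    obtain ⟨ψ', hψ', h⟩ := hpp.exists_mem_Ico₀ hπ ψ
    have hψ'' := Ico_subset_Icc_self hψ'
    rw [h, hpS _ hψ'', Metric.mem_ball, Real.dist_eq]
    have := (hαnear x hx ψ' hψ'').2
    linarith
  have hpd' : ∀ ψ, HasDerivAt p (ε * R (ε, ψ, p ψ)) ψ := by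
    intro ψ
    have := hpd ψ
    simp only [hv] at this
    rwa [hpre _ (Metric.ball_subset_closedBall (hpmem ψ))] at this
  refine ⟨p, hpp, hpmem, hpd', ?_⟩
  intro ψ ρ ω T k hk hT hψ hω hρ hρm hρT hψT
  set n : ℝ → ℝ := fun u => σ * m u - c with hn
  have hnc : Continuous n := (continuous_const.mul hmc).sub continuous_const
  have hnp : Function.Periodic n (2 * Real.pi) := fun u => by simp only [hn, hmp u]
  have hJ : 0 < ∫ u in 0..2 * Real.pi, n u := by
    simp only [hn]
    have i1 : IntervalIntegrable (fun u => σ * m u) volume 0 (2 * Real.pi) :=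
      (continuous_const.mul hmc).intervalIntegrable _ _
    rw [intervalIntegral.integral_sub i1 intervalIntegrable_const, intervalIntegral.integral_const_mul,
      intervalIntegral.integral_const, ← hκ, hc, smul_eq_mul, sub_zero]
    have : 2 * Real.pi * (κ / (16 * Real.pi)) = κ / 8 := by field_simp; norm_num
    rw [this]; linarith
  set N : ℝ → ℝ := fun u => ∫ s in 0..u, n s with hN
  have hNd : ∀ u, HasDerivAt N (n u) u := fun u =>
    intervalIntegral.integral_hasDerivAt_right (hnc.intervalIntegrable _ _)
      (hnc.stronglyMeasurableAtFilter _ _) hnc.continuousAt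
  have hNT : N (ψ T) = N (ψ 0) + k * ∫ u in 0..2 * Real.pi, n u := by
    have e := hnp.intervalIntegral_add_zsmul_eq (k : ℤ) (ψ 0)
      (fun a b => hnc.intervalIntegrable a b)
    simp only [zsmul_eq_mul, Int.cast_natCast] at e
    have := intervalIntegral.integral_add_adjacent_intervals (a := 0) (b := ψ 0) (c := ψ T)
      (hnc.intervalIntegrable (μ := volume) _ _) (hnc.intervalIntegrable _ _)
    simp only [hN]
    rw [← this, hψT, e, hnp.intervalIntegral_add_eq (ψ 0) 0, zero_add]
  set D : ℝ → ℝ := fun t => ρ t - p (ψ t) with hD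
  have hDd : ∀ t, HasDerivAt D (ω t * ε * (R (ε, ψ t, ρ t) - R (ε, ψ t, p (ψ t)))) t := by
    intro t
    have := (hρ t).sub ((hpd' (ψ t)).comp t (hψ t))
    refine this.congr_deriv ?_
    ring
  have hDT : D T = D 0 := by
    simp only [hD]
    rw [hρT, hψT]
    have := hpp.nat_mul k (ψ 0)
    rw [this]
  set E : ℝ → ℝ := fun t => σ * (D t ^ 2 * Real.exp (-2 * ε * σ * N (ψ t))) with hE
  have hEd : ∀ t, HasDerivAt E (2 * ε * ω t * Real.exp (-2 * ε * σ * N (ψ t)) *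
      (σ * D t * (R (ε, ψ t, ρ t) - R (ε, ψ t, p (ψ t))) - n (ψ t) * D t ^ 2)) t := by
    intro t
    have d1 := ((hNd (ψ t)).comp t (hψ t)).const_mul (-2 * ε * σ)
    have d2 := (((hDd t).pow 2).mul d1.exp).const_mul σ
    refine d2.congr_deriv ?_
    simp only [Function.comp_apply, Pi.pow_apply]
    push_cast
    linear_combination (-2 * ε * ω t * Real.exp (-2 * ε * σ * N (ψ t)) * n (ψ t) * D t ^ 2) * hσσ
  have hEmono : Monotone E := by
    refine monotone_of_deriv_nonneg (fun t => (hEd t).differentiableAt) fun t => ?_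
    rw [(hEd t).deriv]
    have hωt := hω t
    refine mul_nonneg (by positivity) ?_
    have e1 := hlip (ψ t) _ (Metric.ball_subset_closedBall (hρm t)) _
      (Metric.ball_subset_closedBall (hpmem (ψ t)))
    set Δ := R (ε, ψ t, ρ t) - R (ε, ψ t, p (ψ t))
    have e2 : |σ * D t * (Δ - m (ψ t) * D t)| ≤ c * D t ^ 2 := by
      rw [abs_mul, abs_mul, hσabs, one_mul, ← sq_abs (D t)]
      calc |D t| * |Δ - m (ψ t) * D t| ≤ |D t| * (c * |D t|) :=
            mul_le_mul_of_nonneg_left e1 (abs_nonneg _)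
        _ = c * |D t| ^ 2 := by ring
    have e3 := (abs_le.1 e2).1
    simp only [hn]
    linarith
  have hET := hEmono hT
  simp only [hE, hDT, hNT] at hET
  have hkJ : 0 < 2 * ε * (k * ∫ u in 0..2 * Real.pi, n u) := by positivity
  have hD0 : D 0 ^ 2 = 0 := by
    by_contra hne
    have hpos : 0 < D 0 ^ 2 := lt_of_le_of_ne (sq_nonneg _) (Ne.symm hne)
    rcases hσ with h | h
    · rw [h, one_mul, one_mul] at hET
      have := Real.exp_le_exp.1 (le_of_mul_le_mul_left hET hpos)
      nlinarith
    · rw [h] at hET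
      have h' : D 0 ^ 2 * Real.exp (-2 * ε * -1 * (N (ψ 0) + k * ∫ u in 0..2 * Real.pi, n u)) ≤
        D 0 ^ 2 * Real.exp (-2 * ε * -1 * N (ψ 0)) := by linarith
      have := Real.exp_le_exp.1 (le_of_mul_le_mul_left h' hpos)
      nlinarith
  have := pow_eq_zero_iff (two_ne_zero) |>.1 hD0
  simp only [hD] at this
  linarith

/-- Polar coordinates along a planar curve avoiding the origin. -/
lemma exists_polar_lift {w y κ β : ℝ → ℝ} (hκ : Continuous κ) (hβ : Continuous β)
    (hw : ∀ t, HasDerivAt w (κ t * y t) t)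
    (hy : ∀ t, HasDerivAt y (-(κ t * w t) - κ t * β t * y t) t)
    (h0 : ∀ t, w t ^ 2 + y t ^ 2 ≠ 0) :
    ∃ ψ ρ : ℝ → ℝ, ∀ t, 0 < ρ t ∧ w t = ρ t * Real.cos (ψ t) ∧ y t = -(ρ t * Real.sin (ψ t)) ∧
      HasDerivAt ψ (κ t * (1 - β t * (Real.sin (ψ t) * Real.cos (ψ t)))) t ∧
      HasDerivAt ρ (-(κ t * β t * ρ t * Real.sin (ψ t) ^ 2)) t := by
  set z : ℝ → ℂ := fun t => (w t : ℂ) - y t * Complex.I with hz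
  have hzre : ∀ t, (z t).re = w t := fun t => by simp [hz]
  have hzim : ∀ t, (z t).im = -y t := fun t => by simp [hz]
  have hz0 : ∀ t, z t ≠ 0 := fun t h => by
    have h1 := hzre t
    have h2 := hzim t
    rw [h] at h1 h2
    simp only [Complex.zero_re, Complex.zero_im] at h1 h2
    apply h0 t
    rw [← h1, show y t = 0 by linarith]
    norm_num
  set z' : ℝ → ℂ := fun t =>
    ((κ t * y t : ℝ) : ℂ) - ((-(κ t * w t) - κ t * β t * y t : ℝ) : ℂ) * Complex.I with hz'
  have hzd : ∀ t, HasDerivAt z (z' t) t := fun t =>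
    ((hw t).ofReal_comp).sub ((hy t).ofReal_comp.mul_const Complex.I)
  have hwc : Continuous w := continuous_iff_continuousAt.2 fun t => (hw t).continuousAt
  have hyc : Continuous y := continuous_iff_continuousAt.2 fun t => (hy t).continuousAt
  set u : ℝ → ℂ := fun t => z' t / z t with hu
  have huc : Continuous u := by
    refine Continuous.div ?_ ?_ hz0
    · simp only [hz']; fun_prop
    · simp only [hz]; fun_prop
  set l : ℝ → ℂ := fun t => Complex.log (z 0) + ∫ s in 0..t, u s with hl
  have hld : ∀ t, HasDerivAt l (u t) t := fun t =>
    (intervalIntegral.integral_hasDerivAt_right (huc.intervalIntegrable _ _)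
      (huc.stronglyMeasurableAtFilter _ _) huc.continuousAt).const_add _
  have hconst : ∀ t, z t * Complex.exp (-l t) = 1 := by
    have hd : ∀ t, HasDerivAt (fun t => z t * Complex.exp (-l t)) 0 t := fun t => by
      refine ((hzd t).mul (hld t).neg.cexp).congr_deriv ?_
      simp only [hu, Pi.neg_apply]
      field_simp [hz0 t]
      ring
    intro t
    have := is_const_of_deriv_eq_zero (fun t => (hd t).differentiableAt)
      (fun t => (hd t).deriv) t 0
    rw [this]
    simp only [hl, intervalIntegral.integral_same, add_zero, Complex.exp_neg,
      Complex.exp_log (hz0 0)]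
    exact mul_inv_cancel₀ (hz0 0)
  have hexp : ∀ t, z t = Complex.exp (l t) := fun t => by
    have := hconst t
    rw [Complex.exp_neg] at this
    exact (eq_of_mul_inv_eq_one this)
  refine ⟨fun t => (l t).im, fun t => Real.exp (l t).re, fun t => ?_⟩
  have e1 : w t = Real.exp (l t).re * Real.cos (l t).im := by
    rw [← hzre, hexp, Complex.exp_re]
  have e2 : y t = -(Real.exp (l t).re * Real.sin (l t).im) := by
    rw [← Complex.exp_im, ← hexp, hzim, neg_neg]
  have hu' : u t = ⟨-(κ t * β t * Real.sin (l t).im ^ 2),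
      κ t * (1 - β t * (Real.sin (l t).im * Real.cos (l t).im))⟩ := by
    rw [hu, div_eq_iff (hz0 t)]
    have hsc := Real.sin_sq_add_cos_sq (l t).im
    apply Complex.ext
    · simp only [hz', Complex.mul_re, Complex.sub_re, Complex.ofReal_re, Complex.ofReal_im,
        Complex.I_re, Complex.I_im, hzre, hzim]
      rw [e1, e2]
      ring
    · simp only [hz', Complex.mul_im, Complex.sub_im, Complex.ofReal_re, Complex.ofReal_im,
        Complex.I_re, Complex.I_im, hzre, hzim]
      rw [e1, e2]
      linear_combination (κ t * β t * Real.exp (l t).re * Real.sin (l t).im) * hsc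
  have hre : HasDerivAt (fun t => (l t).re) (u t).re t :=
    Complex.reCLM.hasFDerivAt.comp_hasDerivAt t (hld t)
  have him : HasDerivAt (fun t => (l t).im) (u t).im t :=
    Complex.imCLM.hasFDerivAt.comp_hasDerivAt t (hld t)
  rw [hu'] at hre him
  refine ⟨Real.exp_pos _, e1, e2, him, hre.exp.congr_deriv ?_⟩
  ring

/-- Reparametrisation of the circle by a positive periodic speed. -/
lemma exists_time_change {q : ℝ → ℝ} (hq : Continuous q) (hpos : ∀ ψ, 0 < q ψ)
    (hper : Function.Periodic q (2 * Real.pi)) :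
    ∃ (χ : ℝ → ℝ) (T : ℝ), 0 < T ∧ (∀ t, HasDerivAt χ (q (χ t))⁻¹ t) ∧
      ∀ t, χ (t + T) = χ t + 2 * Real.pi := by
  have hπ : (0 : ℝ) < 2 * Real.pi := by positivity
  set τ : ℝ → ℝ := fun ψ => ∫ s in 0..ψ, q s with hτ
  have hii : ∀ a b, IntervalIntegrable q volume a b := fun a b => hq.intervalIntegrable a b
  have hτd : ∀ ψ, HasDerivAt τ (q ψ) ψ := fun ψ =>
    intervalIntegral.integral_hasDerivAt_right (hii _ _)
      (hq.stronglyMeasurableAtFilter _ _) hq.continuousAt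
  have hτc : Continuous τ := continuous_iff_continuousAt.2 fun t => (hτd t).continuousAt
  have hmono : StrictMono τ := strictMono_of_hasDerivAt_pos hτd hpos
  have hT : 0 < ∫ s in 0..2 * Real.pi, q s :=
    intervalIntegral.intervalIntegral_pos_of_pos (hii _ _) hpos hπ
  have hadd : ∀ ψ, τ (ψ + 2 * Real.pi) = τ ψ + ∫ s in 0..2 * Real.pi, q s := fun ψ => by
    simp only [hτ]
    rw [← intervalIntegral.integral_add_adjacent_intervals (hii 0 ψ) (hii ψ _),
      hper.intervalIntegral_add_eq ψ 0, zero_add]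
  have hsurj : Function.Surjective τ :=
    hτc.surjective (hper.tendsto_atTop_intervalIntegral_of_pos' (hii _ _) hpos hπ)
      (hper.tendsto_atBot_intervalIntegral_of_pos' (hii _ _) hpos hπ)
  set e := hmono.orderIsoOfSurjective τ hsurj with he
  have hτe : ∀ t, τ (e.symm t) = t := fun t => e.apply_symm_apply t
  refine ⟨e.symm, _, hT, fun t => ?_, fun t => ?_⟩
  · exact HasDerivAt.of_local_left_inverse (e.symm.continuous.continuousAt) (hτd _)
      (hpos _).ne' (Eventually.of_forall hτe)
  · apply hmono.injective
    rw [hadd, hτe, hτe]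

lemma range_comp_eq_of_periodic {α : Type*} {φ : ℝ → α} {χ : ℝ → ℝ} {c T : ℝ} {k : ℕ}
    (hφ : Function.Periodic φ c) (hc : 0 < c) (hχ : Continuous χ) (hT : 0 ≤ T) (hk : 0 < k)
    (h : χ T = χ 0 + k * c) : range (fun t => φ (χ t)) = range φ := by
  apply Subset.antisymm
  · rintro _ ⟨t, rfl⟩
    exact mem_range_self _
  · rintro _ ⟨s, rfl⟩
    obtain ⟨s', hs', e⟩ := hφ.exists_mem_Ico hc s (χ 0)
    have hk1 : (1 : ℝ) ≤ k := by exact_mod_cast hk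
    obtain ⟨t, -, ht⟩ := intermediate_value_Icc hT hχ.continuousOn
      (show s' ∈ Icc (χ 0) (χ T) from ⟨hs'.1, by rw [h]; nlinarith [hs'.2]⟩)
    exact ⟨t, by simp only [ht, e]⟩

/-- A chart `x = X w`, with inverse `w = W x`, of the interval `I` in which the potential energy
becomes `w ^ 2 / 2` and the friction coefficient becomes `b w dw = f x dx`. -/
structure WellChart (f g : Polynomial ℝ) (I : Set ℝ) (X X' W b : ℝ → ℝ) : Prop where
  isOpen : IsOpen I
  mem : ∀ w ∈ Ioo (-1 : ℝ) 1, X w ∈ I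
  left_inv : ∀ w ∈ Ioo (-1 : ℝ) 1, W (X w) = w
  hasDerivAt : ∀ w ∈ Ioo (-1 : ℝ) 1, HasDerivAt X (X' w) w
  pos : ∀ w ∈ Ioo (-1 : ℝ) 1, 0 < X' w
  continuousOn : ContinuousOn X' (Ioo (-1) 1)
  potential : ∀ w ∈ Ioo (-1 : ℝ) 1, g.eval (X w) * X' w = w
  friction : ∀ w ∈ Ioo (-1 : ℝ) 1, b w = f.eval (X w) * X' w
  contDiffOn : ContDiffOn ℝ 1 b (Ioo (-1) 1)
  mem_inv : ∀ x ∈ I, W x ∈ Ioo (-1 : ℝ) 1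
  right_inv : ∀ x ∈ I, X (W x) = x
  hasDerivAt_inv : ∀ x ∈ I, HasDerivAt W (X' (W x))⁻¹ x

lemma abs_sin_mul_cos_le (ψ : ℝ) : |Real.sin ψ * Real.cos ψ| ≤ 1 := by
  rw [abs_mul]
  exact mul_le_one₀ (Real.abs_sin_le_one ψ) (abs_nonneg _) (Real.abs_cos_le_one ψ)

lemma mul_cos_mem_Icc {ρ r : ℝ} (h0 : 0 ≤ ρ) (h : ρ ≤ r) (ψ : ℝ) :
    ρ * Real.cos ψ ∈ Icc (-r) r := by
  rw [mem_Icc, ← abs_le, abs_mul, abs_of_nonneg h0]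
  nlinarith [Real.abs_cos_le_one ψ, abs_nonneg (Real.cos ψ)]

/-- The radial equation `dρ/dψ = ε R(ε, ψ, ρ)` of the system in a well chart. -/
noncomputable def radialField (b : ℝ → ℝ) (v : ℝ × ℝ × ℝ) : ℝ :=
  -(v.2.2 * b (v.2.2 * Real.cos v.2.1) * Real.sin v.2.1 ^ 2) /
    (1 - v.1 * b (v.2.2 * Real.cos v.2.1) * (Real.sin v.2.1 * Real.cos v.2.1))

lemma radialField_isolated {b : ℝ → ℝ} (hb : ContDiffOn ℝ 1 b (Ioo (-1) 1)) {ρ₀ : ℝ}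
    (hρ₀ : ρ₀ ∈ Ioo (0 : ℝ) 1)
    (h0 : ∫ ψ in 0..2 * Real.pi, b (ρ₀ * Real.cos ψ) * Real.sin ψ ^ 2 = 0)
    (h1 : ∫ ψ in 0..2 * Real.pi, b (ρ₀ * Real.cos ψ) * Real.cos ψ ^ 2 ≠ 0)
    {V : Set ℝ} (hV : V ∈ 𝓝 ρ₀) :
    ∃ η > 0, Metric.closedBall ρ₀ η ⊆ V ∧ ∀ᶠ ε in 𝓝[>] (0 : ℝ), ∃ p : ℝ → ℝ,
      Function.Periodic p (2 * Real.pi) ∧ (∀ ψ, p ψ ∈ Metric.ball ρ₀ η) ∧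
      (∀ ψ, HasDerivAt p (ε * radialField b (ε, ψ, p ψ)) ψ) ∧
      ∀ (ψ ρ ω : ℝ → ℝ) (T : ℝ) (k : ℕ), 0 < k → 0 ≤ T → (∀ t, HasDerivAt ψ (ω t) t) →
        (∀ t, 0 < ω t) → (∀ t, HasDerivAt ρ (ω t * (ε * radialField b (ε, ψ t, ρ t))) t) →
        (∀ t, ρ t ∈ Metric.ball ρ₀ η) → ρ T = ρ 0 → ψ T = ψ 0 + k * (2 * Real.pi) →
        ρ 0 = p (ψ 0) := by
  have hmem : ∀ ψ, ρ₀ * Real.cos ψ ∈ Ioo (-1 : ℝ) 1 := fun ψ => by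
    have := mul_cos_mem_Icc hρ₀.1.le le_rfl ψ
    exact ⟨by linarith [this.1, hρ₀.2], by linarith [this.2, hρ₀.2]⟩
  have hbd : ∀ ψ, HasDerivAt b (deriv b (ρ₀ * Real.cos ψ)) (ρ₀ * Real.cos ψ) := fun ψ =>
    ((hb.differentiableOn one_ne_zero).differentiableAt
      (isOpen_Ioo.mem_nhds (hmem ψ))).hasDerivAt
  have hbc : Continuous fun ψ => b (ρ₀ * Real.cos ψ) :=
    hb.continuousOn.comp_continuous (by fun_prop) hmem
  have hb'c : Continuous fun ψ => deriv b (ρ₀ * Real.cos ψ) :=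
    (hb.continuousOn_deriv_of_isOpen isOpen_Ioo le_rfl).comp_continuous (by fun_prop) hmem
  refine exists_isolated_periodic_solution (R := radialField b) (m := fun ψ =>
    -((b (ρ₀ * Real.cos ψ) + ρ₀ * (deriv b (ρ₀ * Real.cos ψ) * Real.cos ψ)) * Real.sin ψ ^ 2))
    ?_ ?_ ?_ ?_ ?_ hV
  · intro ε ψ ρ
    simp only [radialField, Real.sin_add_two_pi, Real.cos_add_two_pi]
  · intro ψ
    have hbat : ContDiffAt ℝ 1 (fun v : ℝ × ℝ × ℝ => b (v.2.2 * Real.cos v.2.1)) (0, ψ, ρ₀) :=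
      ContDiffAt.comp (g := b) _ (hb.contDiffAt (isOpen_Ioo.mem_nhds (hmem ψ))) (by fun_prop)
    unfold radialField
    refine ContDiffAt.div ?_ ?_ (by simp)
    · exact ((contDiffAt_snd.snd.mul hbat).mul (by fun_prop)).neg
    · exact contDiffAt_const.sub ((contDiffAt_fst.mul hbat).mul (by fun_prop))
  · intro ψ
    simp only [radialField, zero_mul, sub_zero, div_one]
    have d := (((hasDerivAt_id ρ₀).mul ((hbd ψ).comp ρ₀
      ((hasDerivAt_id ρ₀).mul_const (Real.cos ψ)))).mul_const (Real.sin ψ ^ 2)).neg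
    refine d.congr_deriv ?_
    simp
  · simp only [radialField, zero_mul, sub_zero, div_one]
    rw [intervalIntegral.integral_neg, neg_eq_zero]
    simp only [mul_assoc]
    rw [intervalIntegral.integral_const_mul, h0, mul_zero]
  · have hd : ∀ ψ, HasDerivAt (fun ψ => b (ρ₀ * Real.cos ψ) * (Real.sin ψ * Real.cos ψ))
        (-((b (ρ₀ * Real.cos ψ) + ρ₀ * (deriv b (ρ₀ * Real.cos ψ) * Real.cos ψ)) *
          Real.sin ψ ^ 2) + b (ρ₀ * Real.cos ψ) * Real.cos ψ ^ 2) ψ := by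
      intro ψ
      have d := ((hbd ψ).comp ψ ((Real.hasDerivAt_cos ψ).const_mul ρ₀)).mul
        ((Real.hasDerivAt_sin ψ).mul (Real.hasDerivAt_cos ψ))
      refine d.congr_deriv ?_
      simp only [Function.comp_apply, Pi.mul_apply]
      ring
    have hc1 : Continuous fun ψ => -((b (ρ₀ * Real.cos ψ) +
        ρ₀ * (deriv b (ρ₀ * Real.cos ψ) * Real.cos ψ)) * Real.sin ψ ^ 2) :=
      ((hbc.add (continuous_const.mul (hb'c.mul Real.continuous_cos))).mul
        (Real.continuous_sin.pow 2)).neg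
    have hc2 : Continuous fun ψ => b (ρ₀ * Real.cos ψ) * Real.cos ψ ^ 2 :=
      hbc.mul (Real.continuous_cos.pow 2)
    have e := intervalIntegral.integral_eq_sub_of_hasDerivAt (a := 0) (b := 2 * Real.pi)
      (fun ψ _ => hd ψ) ((hc1.add hc2).intervalIntegrable _ _)
    rw [intervalIntegral.integral_add (hc1.intervalIntegrable _ _) (hc2.intervalIntegrable _ _)]
      at e
    simp only [Real.sin_two_pi, Real.sin_zero, zero_mul, mul_zero, sub_zero] at e
    intro h
    rw [h, zero_add] at e
    exact h1 e

/-- A simple zero of the averaged friction in a well chart gives a limit cycle. -/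
lemma WellChart.exists_isLimitCycle {f g : Polynomial ℝ} {I : Set ℝ} {X X' W b : ℝ → ℝ}
    (h : WellChart f g I X X' W b) {ρ₀ : ℝ} (hρ₀ : ρ₀ ∈ Ioo (0 : ℝ) 1)
    (h0 : ∫ ψ in 0..2 * Real.pi, b (ρ₀ * Real.cos ψ) * Real.sin ψ ^ 2 = 0)
    (h1 : ∫ ψ in 0..2 * Real.pi, b (ρ₀ * Real.cos ψ) * Real.cos ψ ^ 2 ≠ 0)
    {V : Set ℝ} (hV : V ∈ 𝓝 ρ₀) :
    ∀ᶠ ε in 𝓝[>] (0 : ℝ), ∃ Γ, IsLimitCycle (lienard f g ε) Γ ∧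
      Γ ⊆ {p | p.1 ∈ I ∧ √(W p.1 ^ 2 + p.2 ^ 2) ∈ V} := by
  have hV' : V ∩ Ioo 0 ((1 + ρ₀) / 2) ∈ 𝓝 ρ₀ :=
    inter_mem hV (Ioo_mem_nhds hρ₀.1 (by linarith [hρ₀.2]))
  obtain ⟨η, hη, hηV, hev⟩ := radialField_isolated h.contDiffOn hρ₀ h0 h1 hV'
  set r := (1 + ρ₀) / 2 with hr
  have hr1 : r < 1 := by rw [hr]; linarith [hρ₀.2]
  have hball : ∀ ρ ∈ Metric.ball ρ₀ η, 0 < ρ ∧ ρ ≤ r ∧ ρ ∈ V := fun ρ hρ => by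
    have := hηV (Metric.ball_subset_closedBall hρ)
    exact ⟨this.2.1, this.2.2.le, this.1⟩
  have hIcc : Icc (-r) r ⊆ Ioo (-1) 1 := fun w hw =>
    ⟨by linarith [hw.1], by linarith [hw.2]⟩
  obtain ⟨B, hB⟩ := isCompact_Icc.exists_bound_of_continuousOn
    (h.contDiffOn.continuousOn.mono hIcc)
  have hB0 : 0 ≤ B := (norm_nonneg _).trans
    (hB 0 ⟨by linarith [hρ₀.1], by linarith [hρ₀.1]⟩)
  have hsmall : ∀ᶠ ε in 𝓝[>] (0 : ℝ), B * ε < 1 := by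
    have : Tendsto (fun ε : ℝ => B * ε) (𝓝 0) (𝓝 (B * 0)) := (continuous_const_mul B).tendsto 0
    rw [mul_zero] at this
    exact (this.eventually (gt_mem_nhds one_pos)).filter_mono nhdsWithin_le_nhds
  filter_upwards [hev, hsmall, self_mem_nhdsWithin] with ε hp hε1 hε
  have hεpos : 0 < ε := hε
  obtain ⟨p, hpp, hpm, hpd, huniq⟩ := hp
  have hbρ : ∀ ρ ∈ Metric.ball ρ₀ η, ∀ ψ, ρ * Real.cos ψ ∈ Ioo (-1 : ℝ) 1 ∧
      0 < 1 - ε * b (ρ * Real.cos ψ) * (Real.sin ψ * Real.cos ψ) := by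
    intro ρ hρ ψ
    have hm := mul_cos_mem_Icc (hball ρ hρ).1.le (hball ρ hρ).2.1 ψ
    refine ⟨hIcc hm, ?_⟩
    have e1 : |ε * b (ρ * Real.cos ψ) * (Real.sin ψ * Real.cos ψ)| ≤ ε * B * 1 := by
      rw [abs_mul, abs_mul, abs_of_pos hεpos]
      exact mul_le_mul (mul_le_mul_of_nonneg_left (hB _ hm) hεpos.le) (abs_sin_mul_cos_le ψ)
        (abs_nonneg _) (by positivity)
    linarith [(abs_le.1 e1).2]
  have hpc : Continuous p := continuous_iff_continuousAt.2 fun ψ => (hpd ψ).continuousAt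
  have hwm : ∀ ψ, p ψ * Real.cos ψ ∈ Ioo (-1 : ℝ) 1 := fun ψ => (hbρ _ (hpm ψ) ψ).1
  have hDpos : ∀ ψ, 0 < 1 - ε * b (p ψ * Real.cos ψ) * (Real.sin ψ * Real.cos ψ) :=
    fun ψ => (hbρ _ (hpm ψ) ψ).2
  have hbc : Continuous fun ψ => b (p ψ * Real.cos ψ) :=
    h.contDiffOn.continuousOn.comp_continuous (by fun_prop) hwm
  set q : ℝ → ℝ := fun ψ => X' (p ψ * Real.cos ψ) /
    (1 - ε * b (p ψ * Real.cos ψ) * (Real.sin ψ * Real.cos ψ)) with hq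
  have hqc : Continuous q :=
    (h.continuousOn.comp_continuous (by fun_prop) hwm).div
      (continuous_const.sub ((continuous_const.mul hbc).mul
        (Real.continuous_sin.mul Real.continuous_cos))) fun ψ => (hDpos ψ).ne'
  have hqpos : ∀ ψ, 0 < q ψ := fun ψ => div_pos (h.pos _ (hwm ψ)) (hDpos ψ)
  have hqper : Function.Periodic q (2 * Real.pi) := fun ψ => by
    simp only [hq, hpp ψ, Real.sin_add_two_pi, Real.cos_add_two_pi]
  obtain ⟨χ, T, hT, hχd, hχT⟩ := exists_time_change hqc hqpos hqper
  have hχc : Continuous χ := continuous_iff_continuousAt.2 fun t => (hχd t).continuousAt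
  set φ : ℝ → ℝ × ℝ := fun ψ => (X (p ψ * Real.cos ψ), -(p ψ * Real.sin ψ)) with hφ
  have hφper : Function.Periodic φ (2 * Real.pi) := fun ψ => by
    simp only [hφ, hpp ψ, Real.sin_add_two_pi, Real.cos_add_two_pi]
  have hφd : ∀ ψ, HasDerivAt φ (q ψ • lienard f g ε (φ ψ)) ψ := by
    intro ψ
    have d1 := (hpd ψ).mul (Real.hasDerivAt_cos ψ)
    have d2 := (hpd ψ).mul (Real.hasDerivAt_sin ψ)
    have d3 := HasDerivAt.comp (h₂ := X) ψ (h.hasDerivAt _ (hwm ψ)) d1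
    have hX := (h.pos _ (hwm ψ)).ne'
    have hD := (hDpos ψ).ne'
    have hsc := Real.sin_sq_add_cos_sq ψ
    have hg : g.eval (X (p ψ * Real.cos ψ)) = p ψ * Real.cos ψ / X' (p ψ * Real.cos ψ) := by
      rw [eq_div_iff hX, h.potential _ (hwm ψ)]
    have hf : f.eval (X (p ψ * Real.cos ψ)) =
        b (p ψ * Real.cos ψ) / X' (p ψ * Real.cos ψ) := by
      rw [eq_div_iff hX, h.friction _ (hwm ψ)]
    refine (d3.prodMk d2.neg).congr_deriv ?_
    simp only [hφ, hq, lienard, Prod.smul_mk, smul_eq_mul, radialField, hg, hf, Prod.mk.injEq]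
    generalize b (p ψ * Real.cos ψ) = β at *
    generalize X' (p ψ * Real.cos ψ) = ξ at *
    rw [← mul_assoc] at hD
    simp only [← mul_assoc]
    constructor
    · field_simp
      ring
    · field_simp
      linear_combination p ψ * ε * β * Real.sin ψ * hsc
  have hχ0 : χ T = χ 0 + (1 : ℕ) * (2 * Real.pi) := by
    have := hχT 0
    rw [zero_add] at this
    rw [this]; simp
  have hrange : range (fun t => φ (χ t)) = range φ :=
    range_comp_eq_of_periodic hφper (by positivity) hχc hT.le one_pos hχ0
  have hWφ : ∀ ψ, W (φ ψ).1 = p ψ * Real.cos ψ := fun ψ => h.left_inv _ (hwm ψ)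
  have hφI : ∀ ψ, (φ ψ).1 ∈ I := fun ψ => h.mem _ (hwm ψ)
  have hφρ : ∀ ψ, √(W (φ ψ).1 ^ 2 + (φ ψ).2 ^ 2) = p ψ := fun ψ => by
    rw [hWφ, Real.sqrt_eq_iff_mul_self_eq (by positivity) (hball _ (hpm ψ)).1.le]
    simp only [hφ]
    linear_combination (p ψ ^ 2) * Real.sin_sq_add_cos_sq ψ
  set U : Set (ℝ × ℝ) := {v | v.1 ∈ I ∧ √(W v.1 ^ 2 + v.2 ^ 2) ∈ Metric.ball ρ₀ η} with hU
  have hφU : ∀ ψ, φ ψ ∈ U := fun ψ => ⟨hφI ψ, by rw [hφρ]; exact hpm ψ⟩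
  have hUo : IsOpen U := by
    have hWc : ContinuousOn W I := fun x hx => (h.hasDerivAt_inv x hx).continuousAt.continuousWithinAt
    have hc : ContinuousOn (fun v : ℝ × ℝ => √(W v.1 ^ 2 + v.2 ^ 2)) (Prod.fst ⁻¹' I) :=
      Continuous.comp_continuousOn' Real.continuous_sqrt
        (((hWc.comp continuousOn_fst fun _ hv => hv).pow 2).add (continuousOn_snd.pow 2))
    exact hc.isOpen_inter_preimage (h.isOpen.preimage continuous_fst) Metric.isOpen_ball
  refine ⟨range φ, ⟨⟨fun t => φ (χ t), fun t => ?_, ⟨T, hT, fun t => ?_⟩, ?_, hrange.symm⟩,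
    U, hUo, ?_, ?_⟩, ?_⟩
  · have := (hφd (χ t)).scomp t (hχd t)
    rwa [smul_smul, inv_mul_cancel₀ (hqpos _).ne', one_smul] at this
  · simp only [hχT, hφper (χ t)]
  · by_contra! hcon
    have hall : ∀ ψ, φ ψ = φ (χ 0) := fun ψ => by
      obtain ⟨t, ht⟩ : φ ψ ∈ range (fun t => φ (χ t)) := hrange ▸ mem_range_self ψ
      rw [← ht]; exact hcon t 0
    have e1 := congrArg Prod.snd ((hall (Real.pi / 2)).trans (hall (-(Real.pi / 2))).symm)
    simp only [hφ, Real.sin_neg, Real.sin_pi_div_two] at e1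
    linarith [(hball _ (hpm (Real.pi / 2))).1, (hball _ (hpm (-(Real.pi / 2)))).1]
  · rintro _ ⟨ψ, rfl⟩; exact hφU ψ
  · rintro Γ' ⟨γ, hγ, ⟨T', hT', hγT⟩, -, rfl⟩ hΓU
    have hγU : ∀ t, γ t ∈ U := fun t => hΓU (mem_range_self t)
    have hWm : ∀ t, W (γ t).1 ∈ Ioo (-1 : ℝ) 1 := fun t => h.mem_inv _ (hγU t).1
    have hγ1 : ∀ t, HasDerivAt (fun t => (γ t).1) (γ t).2 t := fun t =>
      (hasFDerivAt_fst (𝕜 := ℝ) (p := γ t)).comp_hasDerivAt t (hγ t)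
    have hγ2 : ∀ t, HasDerivAt (fun t => (γ t).2)
        (-(g.eval (γ t).1) - ε * (f.eval (γ t).1) * (γ t).2) t := fun t =>
      (hasFDerivAt_snd (𝕜 := ℝ) (p := γ t)).comp_hasDerivAt t (hγ t)
    have hw : ∀ t, HasDerivAt (fun t => W (γ t).1) ((X' (W (γ t).1))⁻¹ * (γ t).2) t := fun t =>
      HasDerivAt.comp (h₂ := W) t (h.hasDerivAt_inv _ (hγU t).1) (hγ1 t)
    have hwc : Continuous fun t => W (γ t).1 :=
      continuous_iff_continuousAt.2 fun t => (hw t).continuousAt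
    have hκc : Continuous fun t => (X' (W (γ t).1))⁻¹ :=
      (h.continuousOn.comp_continuous hwc hWm).inv₀ fun t => (h.pos _ (hWm t)).ne'
    have hβc : Continuous fun t => ε * b (W (γ t).1) :=
      continuous_const.mul (h.contDiffOn.continuousOn.comp_continuous hwc hWm)
    obtain ⟨ψ, ρ, hψρ⟩ := exists_polar_lift (w := fun t => W (γ t).1) (y := fun t => (γ t).2)
      hκc hβc hw (fun t => (hγ2 t).congr_deriv (by
        have hX := (h.pos _ (hWm t)).ne'
        have e1 := h.potential _ (hWm t)
        have e2 := h.friction _ (hWm t)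
        rw [h.right_inv _ (hγU t).1] at e1 e2
        rw [e2]
        generalize X' (W (γ t).1) = ξ at *
        field_simp
        linear_combination -e1)) fun t ht => by
          have := (hγU t).2
          simp only [ht, Real.sqrt_zero] at this
          exact lt_irrefl _ (hball _ this).1
    have hρ : ∀ t, ρ t ∈ Metric.ball ρ₀ η := fun t => by
      have := (hγU t).2
      obtain ⟨a1, a2, a3, -⟩ := hψρ t
      have e : √(W (γ t).1 ^ 2 + (γ t).2 ^ 2) = ρ t := by
        rw [Real.sqrt_eq_iff_mul_self_eq (by positivity) a1.le, a2, a3]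
        linear_combination (ρ t ^ 2) * Real.sin_sq_add_cos_sq (ψ t)
      rwa [e] at this
    set ω : ℝ → ℝ := fun t => (X' (W (γ t).1))⁻¹ *
      (1 - ε * b (W (γ t).1) * (Real.sin (ψ t) * Real.cos (ψ t))) with hω
    have hψd : ∀ t, HasDerivAt ψ (ω t) t := fun t => (hψρ t).2.2.2.1
    have hωpos : ∀ t, 0 < ω t := fun t => by
      simp only [hω]
      refine mul_pos (inv_pos.2 (h.pos _ (hWm t))) ?_
      rw [(hψρ t).2.1]
      exact (hbρ _ (hρ t) _).2
    have hρd : ∀ t, HasDerivAt ρ (ω t * (ε * radialField b (ε, ψ t, ρ t))) t := fun t => by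
      refine (hψρ t).2.2.2.2.congr_deriv ?_
      simp only [hω, radialField]
      rw [(hψρ t).2.1]
      have := (hbρ _ (hρ t) (ψ t)).2.ne'
      have key : ∀ ξ β r s D : ℝ, D ≠ 0 →
          -(ξ * (ε * β) * r * s ^ 2) = ξ * D * (ε * (-(r * β * s ^ 2) / D)) := by
        intro ξ β r s D hD
        field_simp
      exact key _ _ _ _ _ this
    have hψc : Continuous ψ := continuous_iff_continuousAt.2 fun t => (hψd t).continuousAt
    have hmono : StrictMono ψ := strictMono_of_hasDerivAt_pos hψd hωpos
    have hρT : ∀ t, ρ (t + T') = ρ t := fun t => by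
      obtain ⟨a1, a2, a3, -⟩ := hψρ t
      obtain ⟨b1, b2, b3, -⟩ := hψρ (t + T')
      rw [hγT t, a2] at b2
      rw [hγT t, a3] at b3
      have : ρ (t + T') ^ 2 = ρ t ^ 2 := by
        have s1 := Real.sin_sq_add_cos_sq (ψ t)
        have s2 := Real.sin_sq_add_cos_sq (ψ (t + T'))
        have c1 : (ρ t * Real.cos (ψ t)) ^ 2 = (ρ (t + T') * Real.cos (ψ (t + T'))) ^ 2 := by
          rw [b2]
        have c2 : (ρ t * Real.sin (ψ t)) ^ 2 = (ρ (t + T') * Real.sin (ψ (t + T'))) ^ 2 := by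
          rw [neg_inj.1 b3]
        linear_combination ρ t ^ 2 * s1 - ρ (t + T') ^ 2 * s2 - c1 - c2
      exact (pow_left_inj₀ b1.le a1.le two_ne_zero).1 this
    have hψT : ∀ t, ∃ k : ℕ, 0 < k ∧ ψ (t + T') = ψ t + k * (2 * Real.pi) := fun t => by
      obtain ⟨a1, a2, a3, -⟩ := hψρ t
      obtain ⟨b1, b2, b3, -⟩ := hψρ (t + T')
      rw [hγT t, a2, hρT t] at b2
      rw [hγT t, a3, hρT t] at b3
      have c1 := mul_left_cancel₀ a1.ne' b2
      have c2 := mul_left_cancel₀ a1.ne' (neg_inj.1 b3)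
      obtain ⟨k, hk⟩ := Real.Angle.angle_eq_iff_two_pi_dvd_sub.1
        (Real.Angle.cos_sin_inj c1.symm c2.symm)
      have hlt := hmono (show t < t + T' by linarith)
      have hkpos : 0 < (k : ℝ) := by
        by_contra! hneg
        nlinarith [Real.pi_pos]
      have hk0 : 0 < k := by exact_mod_cast hkpos
      refine ⟨k.toNat, by omega, ?_⟩
      have : ((k.toNat : ℕ) : ℝ) = k := by exact_mod_cast Int.toNat_of_nonneg hk0.le
      rw [this]; linarith
    have hρp : ∀ t, ρ t = p (ψ t) := fun t => by
      obtain ⟨k, hk, hψk⟩ := hψT t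
      have := huniq (fun s => ψ (s + t)) (fun s => ρ (s + t)) (fun s => ω (s + t)) T' k hk hT'.le
        (fun s => (hψd (s + t)).comp_add_const s t) (fun s => hωpos _)
        (fun s => (hρd (s + t)).comp_add_const s t) (fun s => hρ _)
        (by simp only [zero_add, add_comm T' t, hρT]) (by simpa only [zero_add, add_comm T' t])
      simpa only [zero_add] using this
    have hγφ : γ = fun t => φ (ψ t) := by
      funext t
      obtain ⟨a1, a2, a3, -⟩ := hψρ t
      simp only [hφ, ← hρp, ← a2, ← a3]
      rw [h.right_inv _ (hγU t).1]
    obtain ⟨k, hk, hψk⟩ := hψT 0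
    rw [zero_add] at hψk
    rw [hγφ]
    exact range_comp_eq_of_periodic hφper (by positivity) hψc hT'.le hk hψk
  · rintro _ ⟨ψ, rfl⟩
    exact ⟨hφI ψ, by rw [hφρ]; exact (hball _ (hpm ψ)).2.2⟩

noncomputable def chartX (θ a w : ℝ) : ℝ := Real.cos (θ - a * Real.arcsin w)

noncomputable def chartX' (θ a w : ℝ) : ℝ :=
  Real.sin (θ - a * Real.arcsin w) * (a / √(1 - w ^ 2))

/-- The part of `(-1, 1)` covered by `chartX`. -/
def chartDomain (θ a : ℝ) : Set ℝ :=
  Ioo (-1) 1 ∩ {x | |θ - Real.arccos x| < a * (Real.pi / 2)}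

lemma abs_arcsin_lt {w : ℝ} (hw : w ∈ Ioo (-1 : ℝ) 1) : |Real.arcsin w| < Real.pi / 2 :=
  abs_lt.2 ⟨Real.neg_pi_div_two_lt_arcsin.2 hw.1, Real.arcsin_lt_pi_div_two.2 hw.2⟩

lemma hasDerivAt_chartX (θ a : ℝ) {w : ℝ} (hw : w ∈ Ioo (-1 : ℝ) 1) :
    HasDerivAt (chartX θ a) (chartX' θ a w) w := by
  have d := (((Real.hasDerivAt_arcsin hw.1.ne' hw.2.ne).const_mul a).const_sub θ).cos
  refine d.congr_deriv ?_
  simp only [chartX']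
  ring

lemma contDiffAt_chartX' (θ a : ℝ) {w : ℝ} (hw : w ∈ Ioo (-1 : ℝ) 1) :
    ContDiffAt ℝ 1 (chartX' θ a) w := by
  have h1 : ContDiffAt ℝ 1 Real.arcsin w := Real.contDiffAt_arcsin hw.1.ne' hw.2.ne
  have h2 : 0 < 1 - w ^ 2 := by nlinarith [hw.1, hw.2]
  have h3 : ContDiffAt ℝ 1 (fun w : ℝ => √(1 - w ^ 2)) w :=
    ContDiffAt.sqrt (by fun_prop) h2.ne'
  exact (contDiffAt_const.sub (contDiffAt_const.mul h1)).sin.mul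
    (contDiffAt_const.div h3 (Real.sqrt_pos.2 h2).ne')

/-- Around the minimum `cos θ` of the potential `G`, where `G (cos (θ - a φ)) = -cos (2 φ) / 4`,
the function `chartX` provides a well chart. -/
lemma wellChart_cos {f G : Polynomial ℝ} {θ a : ℝ} (ha : 0 < a)
    (hθ : 0 < θ - a * (Real.pi / 2)) (hθ' : θ + a * (Real.pi / 2) < Real.pi)
    (hG : ∀ φ, G.eval (Real.cos (θ - a * φ)) = -(1 / 4) * Real.cos (2 * φ)) :
    WellChart f (derivative G) (chartDomain θ a) (chartX θ a) (chartX' θ a)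
      (fun x => Real.sin ((θ - Real.arccos x) / a))
      (fun w => f.eval (chartX θ a w) * chartX' θ a w) := by
  have hangle : ∀ w ∈ Ioo (-1 : ℝ) 1, |a * Real.arcsin w| < a * (Real.pi / 2) := fun w hw => by
    rw [abs_mul, abs_of_pos ha]
    exact mul_lt_mul_of_pos_left (abs_arcsin_lt hw) ha
  have hφ : ∀ w ∈ Ioo (-1 : ℝ) 1, θ - a * Real.arcsin w ∈ Ioo 0 Real.pi := fun w hw => by
    have := abs_lt.1 (hangle w hw)
    exact ⟨by linarith, by linarith⟩
  have hac : ∀ w ∈ Ioo (-1 : ℝ) 1, Real.arccos (chartX θ a w) = θ - a * Real.arcsin w :=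
    fun w hw => Real.arccos_cos (hφ w hw).1.le (hφ w hw).2.le
  have hα : ∀ x ∈ chartDomain θ a, (θ - Real.arccos x) / a ∈ Ioo (-(Real.pi / 2)) (Real.pi / 2) :=
    fun x hx => by
      have := abs_lt.1 (mem_ofPred_eq ▸ hx.2)
      constructor
      · rw [lt_div_iff₀ ha]; linarith
      · rw [div_lt_iff₀ ha]; linarith
  have has : ∀ x ∈ chartDomain θ a,
      Real.arcsin (Real.sin ((θ - Real.arccos x) / a)) = (θ - Real.arccos x) / a :=
    fun x hx => Real.arcsin_sin (hα x hx).1.le (hα x hx).2.le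
  have hback : ∀ x ∈ chartDomain θ a,
      θ - a * Real.arcsin (Real.sin ((θ - Real.arccos x) / a)) = Real.arccos x := fun x hx => by
    rw [has x hx, mul_div_cancel₀ _ ha.ne']
    ring
  refine ⟨?_, ?_, ?_, fun w hw => hasDerivAt_chartX θ a hw, ?_, ?_, ?_, fun _ _ => rfl, ?_, ?_, ?_, ?_⟩
  · exact isOpen_Ioo.inter (isOpen_lt ((continuous_const.sub Real.continuous_arccos).abs)
      continuous_const)
  · intro w hw
    refine ⟨⟨?_, ?_⟩, ?_⟩
    · have := Real.strictAntiOn_cos ⟨(hφ w hw).1.le, (hφ w hw).2.le⟩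
        (right_mem_Icc.2 Real.pi_pos.le) (hφ w hw).2
      rwa [Real.cos_pi] at this
    · have := Real.strictAntiOn_cos (left_mem_Icc.2 Real.pi_pos.le)
        ⟨(hφ w hw).1.le, (hφ w hw).2.le⟩ (hφ w hw).1
      rwa [Real.cos_zero] at this
    · rw [mem_ofPred_eq, hac w hw, sub_sub_cancel]
      exact hangle w hw
  · intro w hw
    simp only [hac w hw, sub_sub_cancel]
    rw [mul_div_cancel_left₀ _ ha.ne', Real.sin_arcsin hw.1.le hw.2.le]
  · intro w hw
    have h2 : 0 < 1 - w ^ 2 := by nlinarith [hw.1, hw.2]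
    exact mul_pos (Real.sin_pos_of_pos_of_lt_pi (hφ w hw).1 (hφ w hw).2)
      (div_pos ha (Real.sqrt_pos.2 h2))
  · exact fun w hw => (contDiffAt_chartX' θ a hw).continuousAt.continuousWithinAt
  · intro w hw
    have d1 : HasDerivAt (fun w => G.eval (chartX θ a w))
        ((derivative G).eval (chartX θ a w) * chartX' θ a w) w :=
      HasDerivAt.comp (h₂ := fun x => G.eval x) w (G.hasDerivAt _) (hasDerivAt_chartX θ a hw)
    have d2 : HasDerivAt (fun w : ℝ => -(1 / 4) * (1 - 2 * w ^ 2)) w w := by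
      refine ((((hasDerivAt_pow 2 w).const_mul 2).const_sub 1).const_mul (-(1 / 4))).congr_deriv ?_
      push_cast
      ring
    refine d1.unique (d2.congr_of_eventuallyEq ?_)
    filter_upwards [isOpen_Ioo.mem_nhds hw] with u hu
    rw [chartX, hG, Real.cos_two_mul', ← Real.sin_arcsin hu.1.le hu.2.le, Real.arcsin_sin
      (Real.neg_pi_div_two_le_arcsin u) (Real.arcsin_le_pi_div_two u)]
    linear_combination -(1 / 4) * Real.sin_sq_add_cos_sq (Real.arcsin u)
  · refine fun w hw => ContDiffAt.contDiffWithinAt ?_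
    have hX : ContDiffAt ℝ 1 (chartX θ a) w :=
      (contDiffAt_const.sub (contDiffAt_const.mul
        (Real.contDiffAt_arcsin hw.1.ne' hw.2.ne))).cos
    have hf : ContDiff ℝ 1 fun x => f.eval x := by
      simpa only [coe_aeval_eq_eval] using f.contDiff_aeval (𝕜 := ℝ) 1
    exact (hf.contDiffAt.comp w hX).mul (contDiffAt_chartX' θ a hw)
  · intro x hx
    have h1 := Real.strictMonoOn_sin (left_mem_Icc.2 (by linarith [Real.pi_pos]))
      ⟨(hα x hx).1.le, (hα x hx).2.le⟩ (hα x hx).1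
    have h2 := Real.strictMonoOn_sin ⟨(hα x hx).1.le, (hα x hx).2.le⟩
      (right_mem_Icc.2 (by linarith [Real.pi_pos])) (hα x hx).2
    rw [Real.sin_neg, Real.sin_pi_div_two] at h1
    rw [Real.sin_pi_div_two] at h2
    exact ⟨h1, h2⟩
  · intro x hx
    rw [chartX, hback x hx, Real.cos_arccos hx.1.1.le hx.1.2.le]
  · intro x hx
    have d := (((Real.hasDerivAt_arccos hx.1.1.ne' hx.1.2.ne).const_sub θ).div_const a).sin
    refine d.congr_deriv ?_
    have hc := Real.cos_pos_of_mem_Ioo (hα x hx)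
    rw [chartX', hback x hx, Real.sin_arccos, ← Real.cos_sq', Real.sqrt_sq hc.le]
    have h2 : 0 < 1 - x ^ 2 := by nlinarith [hx.1.1, hx.1.2]
    have h3 := (Real.sqrt_pos.2 h2).ne'
    field_simp

lemma mul_cos_mem_Ioo {ρ : ℝ} (hρ : ρ ∈ Ioo (-1 : ℝ) 1) (ψ : ℝ) :
    ρ * Real.cos ψ ∈ Ioo (-1 : ℝ) 1 := by
  have h1 : |ρ| < 1 := abs_lt.2 hρ
  rw [mem_Ioo, ← abs_lt, abs_mul]
  nlinarith [Real.abs_cos_le_one ψ, abs_nonneg (Real.cos ψ), abs_nonneg ρ]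

/-- The weighted average `∫ b (ρ cos ψ) k(ψ) dψ` over a circle of radius `ρ`. -/
noncomputable def circleMean (k b : ℝ → ℝ) (ρ : ℝ) : ℝ :=
  ∫ ψ in 0..2 * Real.pi, b (ρ * Real.cos ψ) * k ψ

lemma continuous_circle {k b : ℝ → ℝ} (hk : Continuous k) (hb : ContinuousOn b (Ioo (-1) 1))
    {ρ : ℝ} (hρ : ρ ∈ Ioo (-1 : ℝ) 1) : Continuous fun ψ => b (ρ * Real.cos ψ) * k ψ :=
  (hb.comp_continuous (by fun_prop) (mul_cos_mem_Ioo hρ)).mul hk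

lemma circleMean_sum {ι : Type*} (s : Finset ι) {k : ℝ → ℝ} (hk : Continuous k)
    {b : ι → ℝ → ℝ} (c : ι → ℝ) {B : ℝ → ℝ} (hb : ∀ i ∈ s, ContinuousOn (b i) (Ioo (-1) 1))
    (hB : ∀ w ∈ Ioo (-1 : ℝ) 1, B w = ∑ i ∈ s, c i * b i w) {ρ : ℝ} (hρ : ρ ∈ Ioo (-1 : ℝ) 1) :
    circleMean k B ρ = ∑ i ∈ s, c i * circleMean k (b i) ρ := by
  simp only [circleMean]
  simp_rw [hB _ (mul_cos_mem_Ioo hρ _), Finset.sum_mul, mul_assoc]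
  have hi : ∀ i ∈ s, IntervalIntegrable (fun ψ => c i * (b i (ρ * Real.cos ψ) * k ψ)) volume 0
      (2 * Real.pi) := fun i hi =>
    (continuous_const.mul (continuous_circle hk (hb i hi) hρ)).intervalIntegrable _ _
  rw [intervalIntegral.integral_finsetSum hi]
  simp_rw [intervalIntegral.integral_const_mul]

lemma circleMean_eq_zero_of_odd {k b : ℝ → ℝ} (hk : Continuous k)
    (hkp : ∀ ψ, k (ψ + Real.pi) = k ψ) (hb : ContinuousOn b (Ioo (-1) 1))
    (hodd : ∀ w ∈ Ioo (-1 : ℝ) 1, b (-w) = -b w) {ρ : ℝ} (hρ : ρ ∈ Ioo (-1 : ℝ) 1) :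
    circleMean k b ρ = 0 := by
  have hc := continuous_circle hk hb hρ
  have e1 : ∫ ψ in Real.pi..2 * Real.pi, b (ρ * Real.cos ψ) * k ψ =
      -∫ ψ in 0..Real.pi, b (ρ * Real.cos ψ) * k ψ := by
    have := intervalIntegral.integral_comp_add_right (a := 0) (b := Real.pi)
      (fun ψ => b (ρ * Real.cos ψ) * k ψ) Real.pi
    rw [zero_add, ← two_mul] at this
    rw [← this, ← intervalIntegral.integral_neg]
    refine intervalIntegral.integral_congr fun ψ _ => ?_
    simp only [Real.cos_add_pi, hkp, mul_neg, hodd _ (mul_cos_mem_Ioo hρ ψ), neg_mul]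
  rw [circleMean, ← intervalIntegral.integral_add_adjacent_intervals
    (hc.intervalIntegrable 0 Real.pi) (hc.intervalIntegrable _ _), e1, add_neg_cancel]

lemma exists_continuous_extension {b : ℝ → ℝ} (hb : ContinuousOn b (Ioo (-1) 1)) {r : ℝ}
    (h0 : 0 ≤ r) (h1 : r < 1) : ∃ b' : ℝ → ℝ, Continuous b' ∧ ∀ w ∈ Icc (-r) r, b' w = b w := by
  refine ⟨fun w => b (max (-r) (min r w)), ?_, fun w hw => ?_⟩
  · refine hb.comp_continuous (by fun_prop) fun w => ⟨?_, ?_⟩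
    · exact lt_max_of_lt_left (by linarith)
    · exact max_lt (by linarith) (min_lt_of_left_lt h1)
  · simp only [min_eq_right hw.2, max_eq_right hw.1]

lemma continuousOn_circleMean {k b : ℝ → ℝ} (hk : Continuous k)
    (hb : ContinuousOn b (Ioo (-1) 1)) : ContinuousOn (circleMean k b) (Ioo (-1) 1) := by
  intro ρ hρ
  have hρ' : |ρ| < 1 := abs_lt.2 hρ
  obtain ⟨b', hb', he⟩ := exists_continuous_extension hb (r := (1 + |ρ|) / 2)
    (by positivity) (by linarith)
  have hc : Continuous (circleMean k b') :=
    intervalIntegral.continuous_parametric_intervalIntegral_of_continuous' (by fun_prop) _ _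
  refine (hc.continuousAt.congr ?_).continuousWithinAt
  have hn : ∀ᶠ x in 𝓝 ρ, |x| < (1 + |ρ|) / 2 :=
    continuous_abs.continuousAt.eventually (gt_mem_nhds (by linarith))
  filter_upwards [hn] with x hx
  refine intervalIntegral.integral_congr fun ψ _ => ?_
  have hm : x * Real.cos ψ ∈ Icc (-((1 + |ρ|) / 2)) ((1 + |ρ|) / 2) := by
    rw [mem_Icc, ← abs_le, abs_mul]
    nlinarith [Real.abs_cos_le_one ψ, abs_nonneg (Real.cos ψ), abs_nonneg x]
  simp only [he _ hm]

lemma integral_mul_cos_eq {Φ b : ℝ → ℝ} (hb : ContinuousOn b (Ioo (-1) 1))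
    (hΦ : ∀ w ∈ Ioo (-1 : ℝ) 1, HasDerivAt Φ (b w) w) {ρ : ℝ} (hρ : ρ ∈ Ioo (-1 : ℝ) 1) :
    ∫ ψ in 0..2 * Real.pi, Φ (ρ * Real.cos ψ) * Real.cos ψ =
      ρ * circleMean (fun ψ => Real.sin ψ ^ 2) b ρ := by
  have hΦc : ContinuousOn Φ (Ioo (-1) 1) := fun w hw => (hΦ w hw).continuousAt.continuousWithinAt
  have hc1 := continuous_circle Real.continuous_cos hΦc hρ
  have hc2 : Continuous fun ψ => ρ * (b (ρ * Real.cos ψ) * Real.sin ψ ^ 2) :=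
    continuous_const.mul (continuous_circle (Real.continuous_sin.pow 2) hb hρ)
  have hd : ∀ ψ, HasDerivAt (fun ψ => Φ (ρ * Real.cos ψ) * Real.sin ψ)
      (Φ (ρ * Real.cos ψ) * Real.cos ψ - ρ * (b (ρ * Real.cos ψ) * Real.sin ψ ^ 2)) ψ := by
    intro ψ
    have d := (HasDerivAt.comp (h₂ := Φ) ψ (hΦ _ (mul_cos_mem_Ioo hρ ψ))
      ((Real.hasDerivAt_cos ψ).const_mul ρ)).mul (Real.hasDerivAt_sin ψ)
    refine d.congr_deriv ?_
    simp only [Function.comp_apply]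
    ring
  have e := intervalIntegral.integral_eq_sub_of_hasDerivAt (a := 0) (b := 2 * Real.pi)
    (fun ψ _ => hd ψ) ((hc1.sub hc2).intervalIntegrable _ _)
  rw [intervalIntegral.integral_sub (hc1.intervalIntegrable _ _)
    (hc2.intervalIntegrable _ _), intervalIntegral.integral_const_mul] at e
  simp only [Real.sin_two_pi, Real.sin_zero, mul_zero, sub_zero] at e
  rw [circleMean]
  linarith

lemma hasDerivAt_circleMean {Φ b : ℝ → ℝ} (hb : ContinuousOn b (Ioo (-1) 1))
    (hΦ : ∀ w ∈ Ioo (-1 : ℝ) 1, HasDerivAt Φ (b w) w) {ρ : ℝ} (hρ : ρ ∈ Ioo (-1 : ℝ) 1) :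
    HasDerivAt (fun ρ => ρ * circleMean (fun ψ => Real.sin ψ ^ 2) b ρ)
      (circleMean (fun ψ => Real.cos ψ ^ 2) b ρ) ρ := by
  have hΦc : ContinuousOn Φ (Ioo (-1) 1) := fun w hw => (hΦ w hw).continuousAt.continuousWithinAt
  have hρ' : |ρ| < 1 := abs_lt.2 hρ
  set r := (1 + |ρ|) / 2 with hr
  have hr1 : r < 1 := by rw [hr]; linarith
  have hIcc : Icc (-r) r ⊆ Ioo (-1) 1 := fun w hw => ⟨by linarith [hw.1], by linarith [hw.2]⟩
  obtain ⟨B, hB⟩ := isCompact_Icc.exists_bound_of_continuousOn (hb.mono hIcc)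
  have hball : Ioo (-r) r ∈ 𝓝 ρ := by
    have : |ρ| < r := by rw [hr]; linarith
    exact Ioo_mem_nhds (abs_lt.1 this).1 (abs_lt.1 this).2
  have hsub : Ioo (-r) r ⊆ Ioo (-1) 1 := Ioo_subset_Icc_self.trans hIcc
  have key := (intervalIntegral.hasDerivAt_integral_of_dominated_loc_of_deriv_le
    (F := fun ρ ψ => Φ (ρ * Real.cos ψ) * Real.cos ψ)
    (F' := fun ρ ψ => b (ρ * Real.cos ψ) * Real.cos ψ ^ 2) (μ := volume) (a := 0)
    (b := 2 * Real.pi) (bound := fun _ => B) hball ?_ ?_ ?_ ?_ ?_ ?_).2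
  · refine key.congr_of_eventuallyEq ?_
    filter_upwards [hball] with x hx
    exact (integral_mul_cos_eq hb hΦ (hsub hx)).symm
  · filter_upwards [hball] with x hx
    exact (continuous_circle Real.continuous_cos hΦc (hsub hx)).aestronglyMeasurable
  · exact (continuous_circle Real.continuous_cos hΦc hρ).intervalIntegrable _ _
  · exact (continuous_circle (Real.continuous_cos.pow 2) hb hρ).aestronglyMeasurable
  · refine Eventually.of_forall fun ψ _ x hx => ?_
    have hm : x * Real.cos ψ ∈ Icc (-r) r := by
      have := abs_lt.2 hx
      rw [mem_Icc, ← abs_le, abs_mul]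
      nlinarith [Real.abs_cos_le_one ψ, abs_nonneg (Real.cos ψ), abs_nonneg x]
    have e := hB _ hm
    rw [norm_mul, norm_pow, Real.norm_eq_abs (Real.cos ψ), sq_abs]
    nlinarith [Real.cos_sq_le_one ψ, sq_nonneg (Real.cos ψ), norm_nonneg (b (x * Real.cos ψ))]
  · exact intervalIntegrable_const
  · refine Eventually.of_forall fun ψ _ x hx => ?_
    have d := (HasDerivAt.comp (h₂ := Φ) x (hΦ _ (mul_cos_mem_Ioo (hsub hx) ψ))
      ((hasDerivAt_id x).mul_const (Real.cos ψ))).mul_const (Real.cos ψ)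
    refine d.congr_deriv ?_
    simp only [id]
    ring

/-- Simple zeros persist under continuous perturbations. -/
lemma eventually_exists_simple_zero {A A' : ℝ × ℝ → ℝ} {U : Set ℝ} (hU : IsOpen U) {r₀ : ℝ}
    (hr₀ : r₀ ∈ U) (hA : ContinuousOn A (univ ×ˢ U)) (hA' : ContinuousOn A' (univ ×ˢ U))
    (h0 : A (0, r₀) = 0) (hd : HasDerivAt (fun r => A (0, r)) (A' (0, r₀)) r₀)
    (h1 : A' (0, r₀) ≠ 0) {V : Set ℝ} (hV : V ∈ 𝓝 r₀) :
    ∀ᶠ δ in 𝓝 (0 : ℝ), ∃ r ∈ V, A (δ, r) = 0 ∧ A' (δ, r) ≠ 0 := by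
  have hopen : IsOpen ((univ : Set ℝ) ×ˢ U) := isOpen_univ.prod hU
  have hne : ∀ᶠ x in 𝓝 ((0 : ℝ), r₀), A' x ≠ 0 :=
    (hA'.continuousAt (hopen.mem_nhds ⟨mem_univ _, hr₀⟩)).eventually_ne h1
  rw [nhds_prod_eq] at hne
  obtain ⟨P, hP, Q, hQ, hPQ⟩ := Filter.eventually_prod_iff.1 hne
  obtain ⟨η, hη, hball⟩ := Metric.mem_nhds_iff.1
    (inter_mem (inter_mem hV (hU.mem_nhds hr₀)) (show {r | Q r} ∈ 𝓝 r₀ from hQ))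
  set c := A' (0, r₀) with hc
  have hslope : ∀ᶠ r in 𝓝[≠] r₀, 0 < c * slope (fun r => A (0, r)) r₀ r := by
    have := (hasDerivAt_iff_tendsto_slope.1 hd).const_mul c
    exact this.eventually (lt_mem_nhds (mul_self_pos.2 h1))
  have hnear : ∀ᶠ r in 𝓝 r₀, r ∈ Metric.ball r₀ η := Metric.ball_mem_nhds _ hη
  have hgt : 𝓝[>] r₀ ≤ 𝓝[≠] r₀ := nhdsWithin_mono _ fun x (hx : r₀ < x) => hx.ne'
  have hlt : 𝓝[<] r₀ ≤ 𝓝[≠] r₀ := nhdsWithin_mono _ fun x (hx : x < r₀) => hx.ne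
  obtain ⟨r₂, ⟨hs₂, hb₂⟩, hr₂⟩ := (((hslope.filter_mono hgt).and
      (hnear.filter_mono nhdsWithin_le_nhds)).and
        (self_mem_nhdsWithin (a := r₀) (s := Ioi r₀))).exists
  obtain ⟨r₁, ⟨hs₁, hb₁⟩, hr₁⟩ := (((hslope.filter_mono hlt).and
      (hnear.filter_mono nhdsWithin_le_nhds)).and
        (self_mem_nhdsWithin (a := r₀) (s := Iio r₀))).exists
  have hr₂' : r₀ < r₂ := hr₂
  have hr₁' : r₁ < r₀ := hr₁
  have hA₂ : 0 < c * A (0, r₂) := by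
    rw [slope_def_field, h0, sub_zero, ← mul_div_assoc, lt_div_iff₀ (by linarith)] at hs₂
    linarith
  have hA₁ : c * A (0, r₁) < 0 := by
    rw [slope_def_field, h0, sub_zero, ← mul_div_assoc, lt_div_iff_of_neg (by linarith)] at hs₁
    linarith
  have hcont : ∀ r ∈ U, ContinuousAt (fun δ => c * A (δ, r)) 0 := fun r hr =>
    continuousAt_const.mul (ContinuousAt.comp (f := fun δ : ℝ => (δ, r))
      (hA.continuousAt (hopen.mem_nhds ⟨mem_univ _, hr⟩)) (by fun_prop))
  filter_upwards [(hcont r₂ (hball hb₂).1.2).eventually (lt_mem_nhds hA₂),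
    (hcont r₁ (hball hb₁).1.2).eventually (gt_mem_nhds hA₁), hP] with δ h₂ h₁ hδ
  have hsub : Icc r₁ r₂ ⊆ Metric.ball r₀ η := by
    rw [Real.ball_eq_Ioo] at *
    exact fun x hx => ⟨hb₁.1.trans_le hx.1, hx.2.trans_lt hb₂.2⟩
  have hcI : ContinuousOn (fun r => c * A (δ, r)) (Icc r₁ r₂) :=
    continuousOn_const.mul (hA.comp (by fun_prop) fun r hr =>
      ⟨mem_univ _, (hball (hsub hr)).1.2⟩)
  obtain ⟨r, hr, hr0⟩ := intermediate_value_Icc (hr₁'.trans hr₂').le hcI ⟨h₁.le, h₂.le⟩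
  exact ⟨r, (hball (hsub hr)).1.1, (mul_eq_zero.1 hr0).resolve_left h1,
    hPQ hδ (hball (hsub hr)).2⟩

lemma integral_cos_pow_even_pos (i : ℕ) :
    0 < ∫ ψ in 0..2 * Real.pi, Real.cos ψ ^ (2 * i + 2) := by
  have hπ : (0 : ℝ) < 2 * Real.pi := by positivity
  refine intervalIntegral.integral_pos hπ (by fun_prop) (fun x _ => ?_)
    ⟨0, left_mem_Icc.2 hπ.le, by simp⟩
  rw [show 2 * i + 2 = 2 * (i + 1) by ring, pow_mul]
  positivity

/-- An odd polynomial whose averages along circles are `r * Q (r ^ 2)`. -/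
lemma exists_odd_polynomial_integral_eq {a : ℝ} (ha : a ≠ 0) (Q : Polynomial ℝ) :
    ∃ p : Polynomial ℝ, p.natDegree ≤ 2 * Q.natDegree + 1 ∧ (∀ v, p.eval (-v) = -p.eval v) ∧
      ∀ r, ∫ ψ in 0..2 * Real.pi, p.eval (a * (r * Real.cos ψ)) * Real.cos ψ =
        r * Q.eval (r ^ 2) := by
  set K : ℕ → ℝ := fun i => ∫ ψ in 0..2 * Real.pi, Real.cos ψ ^ (2 * i + 2) with hK
  have hKpos : ∀ i, 0 < K i := integral_cos_pow_even_pos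
  refine ⟨∑ i ∈ Finset.range (Q.natDegree + 1),
    Polynomial.C (Q.coeff i / (a ^ (2 * i + 1) * K i)) * Polynomial.X ^ (2 * i + 1), ?_, ?_, ?_⟩
  · refine natDegree_sum_le_of_forall_le _ _ fun i hi => ?_
    refine (natDegree_C_mul_X_pow_le _ _).trans ?_
    have := Finset.mem_range.1 hi
    omega
  · intro v
    simp only [eval_finsetSum, eval_mul, eval_C, eval_pow, eval_X, ← Finset.sum_neg_distrib]
    refine Finset.sum_congr rfl fun i _ => ?_
    rw [Odd.neg_pow ⟨i, rfl⟩, mul_neg]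
  · intro r
    have e : ∀ ψ : ℝ, (∑ i ∈ Finset.range (Q.natDegree + 1),
        Polynomial.C (Q.coeff i / (a ^ (2 * i + 1) * K i)) *
          Polynomial.X ^ (2 * i + 1)).eval (a * (r * Real.cos ψ)) * Real.cos ψ =
        ∑ i ∈ Finset.range (Q.natDegree + 1),
          Q.coeff i * r ^ (2 * i + 1) / K i * Real.cos ψ ^ (2 * i + 2) := by
      intro ψ
      simp only [eval_finsetSum, eval_mul, eval_C, eval_pow, eval_X, Finset.sum_mul]
      refine Finset.sum_congr rfl fun i _ => ?_
      have := (hKpos i).ne'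
      field_simp
      ring
    simp_rw [e]
    rw [intervalIntegral.integral_finsetSum fun i _ =>
      Continuous.intervalIntegrable (by fun_prop) _ _]
    rw [eval_eq_sum_range, Finset.mul_sum]
    refine Finset.sum_congr rfl fun i _ => ?_
    rw [intervalIntegral.integral_const_mul, div_mul_cancel₀ _ (hKpos i).ne', ← pow_mul]
    ring

noncomputable def sineChart (a w : ℝ) : ℝ := Real.sin (a * Real.arcsin w)

noncomputable def sineChart' (a w : ℝ) : ℝ := Real.cos (a * Real.arcsin w) * (a / √(1 - w ^ 2))

lemma continuous_sineChart (a : ℝ) : Continuous (sineChart a) := by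
  have := Real.continuous_arcsin
  unfold sineChart
  fun_prop

lemma hasDerivAt_sineChart (a : ℝ) {w : ℝ} (hw : w ∈ Ioo (-1 : ℝ) 1) :
    HasDerivAt (sineChart a) (sineChart' a w) w := by
  refine ((Real.hasDerivAt_arcsin hw.1.ne' hw.2.ne).const_mul a).sin.congr_deriv ?_
  rw [sineChart']
  ring

lemma continuousOn_sineChart' (a : ℝ) : ContinuousOn (sineChart' a) (Ioo (-1) 1) := by
  have h := Real.continuous_arcsin
  unfold sineChart'
  refine ContinuousOn.mul (by fun_prop) (ContinuousOn.div (by fun_prop) (by fun_prop) ?_)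
  intro w hw
  exact (Real.sqrt_pos.2 (by nlinarith [hw.1, hw.2])).ne'

/-- The friction coefficient in a well chart of the composition of an odd polynomial with a
Chebyshev polynomial. -/
noncomputable def levelFriction (a : ℝ) (P : Polynomial ℝ) (w : ℝ) : ℝ :=
  (derivative P).eval (sineChart a w) * sineChart' a w

lemma continuousOn_levelFriction (a : ℝ) (P : Polynomial ℝ) :
    ContinuousOn (levelFriction a P) (Ioo (-1) 1) :=
  ((derivative P).continuous.comp (continuous_sineChart a)).continuousOn.mul
    (continuousOn_sineChart' a)

lemma hasDerivAt_levelFriction (a : ℝ) (P : Polynomial ℝ) {w : ℝ} (hw : w ∈ Ioo (-1 : ℝ) 1) :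
    HasDerivAt (fun w => P.eval (sineChart a w)) (levelFriction a P w) w :=
  HasDerivAt.comp (h₂ := fun x => P.eval x) w (P.hasDerivAt _) (hasDerivAt_sineChart a hw)

lemma hasDerivAt_mul_eval_sq (Q : Polynomial ℝ) (x : ℝ) :
    HasDerivAt (fun r => r * Q.eval (r ^ 2))
      (1 * Q.eval (x ^ 2) + x * ((derivative Q).eval (x ^ 2) * (2 * x))) x := by
  have h := HasDerivAt.comp (h₂ := fun y => Q.eval y) x (Q.hasDerivAt (x ^ 2))
    (hasDerivAt_pow 2 x)
  refine ((hasDerivAt_id x).mul h).congr_deriv ?_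
  simp

/-- A rescaled family of odd polynomials together with the continuous extension of its averages. -/
lemma exists_rescaled_family {a : ℝ} (ha : 0 < a) (Q : Polynomial ℝ) :
    ∃ (P : ℝ → Polynomial ℝ) (A A' : ℝ × ℝ → ℝ),
      (∀ η, (P η).natDegree ≤ 2 * Q.natDegree + 1) ∧ (∀ η v, (P η).eval (-v) = -(P η).eval v) ∧
      Continuous A ∧ Continuous A' ∧ (∀ r, A (0, r) = r * Q.eval (r ^ 2)) ∧
      (∀ r ∈ Ioo (0 : ℝ) 1, HasDerivAt (fun r => A (0, r)) (A' (0, r)) r) ∧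
      ∀ η ∈ Ioo (0 : ℝ) (1 / 2), ∀ r ∈ Ioo (0 : ℝ) 1,
        A (η, r) = η * r * circleMean (fun ψ => Real.sin ψ ^ 2) (levelFriction a (P η)) (η * r) ∧
        A' (η, r) = η * circleMean (fun ψ => Real.cos ψ ^ 2) (levelFriction a (P η)) (η * r) := by
  obtain ⟨p, hpdeg, hpodd, hpint⟩ := exists_odd_polynomial_integral_eq ha.ne' Q
  have hsc : Continuous (sineChart a) := continuous_sineChart a
  obtain ⟨s', hs'c, hs'⟩ := exists_continuous_extension (continuousOn_sineChart' a)
    (r := 1 / 2) (by norm_num) (by norm_num)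
  have hD0 : dslope (sineChart a) 0 0 = a := by
    rw [dslope_same, (hasDerivAt_sineChart a ⟨by norm_num, by norm_num⟩).deriv]
    simp [sineChart']
  have hs'0 : s' 0 = a := by
    rw [hs' 0 ⟨by norm_num, by norm_num⟩]
    simp [sineChart']
  have hDc : Continuous (dslope (sineChart a) 0) := by
    rw [← continuousOn_univ, continuousOn_dslope univ_mem]
    exact ⟨hsc.continuousOn,
      (hasDerivAt_sineChart a ⟨by norm_num, by norm_num⟩).differentiableAt⟩
  have hDs : ∀ w, w * dslope (sineChart a) 0 w = sineChart a w := fun w => by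
    have := sub_smul_dslope (sineChart a) 0 w
    simpa [sineChart] using this
  have hpc : Continuous fun x => p.eval x := p.continuous
  have hp'c : Continuous fun x => (derivative p).eval x := (derivative p).continuous
  set A : ℝ × ℝ → ℝ := fun x => ∫ ψ in 0..2 * Real.pi,
    p.eval (x.2 * Real.cos ψ * dslope (sineChart a) 0 (x.1 * (x.2 * Real.cos ψ))) *
      Real.cos ψ with hA
  set A' : ℝ × ℝ → ℝ := fun x => ∫ ψ in 0..2 * Real.pi,
    (derivative p).eval
      (x.2 * Real.cos ψ * dslope (sineChart a) 0 (x.1 * (x.2 * Real.cos ψ))) *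
      s' (x.1 * (x.2 * Real.cos ψ)) * Real.cos ψ ^ 2 with hA'
  have hAc : Continuous A :=
    intervalIntegral.continuous_parametric_intervalIntegral_of_continuous' (by fun_prop) _ _
  have hA'c : Continuous A' :=
    intervalIntegral.continuous_parametric_intervalIntegral_of_continuous' (by fun_prop) _ _
  have hA0 : ∀ r, A (0, r) = r * Q.eval (r ^ 2) := fun r => by
    rw [← hpint]
    simp only [hA, zero_mul, hD0, mul_comm a]
  have hA0d : ∀ r ∈ Ioo (0 : ℝ) 1, HasDerivAt (fun r => A (0, r)) (A' (0, r)) r := by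
    intro r hr
    have hr' : r ∈ Ioo (-1 : ℝ) 1 := ⟨by linarith [hr.1], hr.2⟩
    have hb : ContinuousOn (fun w => (derivative p).eval (a * w) * a) (Ioo (-1) 1) :=
      Continuous.continuousOn (by fun_prop)
    have hΦ : ∀ w ∈ Ioo (-1 : ℝ) 1, HasDerivAt (fun w => p.eval (a * w))
        ((derivative p).eval (a * w) * a) w := fun w _ => by
      have := HasDerivAt.comp (h₂ := fun x => p.eval x) w (p.hasDerivAt _)
        ((hasDerivAt_id w).const_mul a)
      exact this.congr_deriv (by simp)
    have d := hasDerivAt_circleMean hb hΦ hr'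
    refine (d.congr_of_eventuallyEq ?_).congr_deriv ?_
    · filter_upwards [isOpen_Ioo.mem_nhds hr'] with x hx
      have e := integral_mul_cos_eq hb hΦ hx
      rw [hpint] at e
      exact (hA0 x).trans e
    · simp only [hA', circleMean, zero_mul, hD0, hs'0, mul_comm a]
  refine ⟨fun η => p.comp (Polynomial.C η⁻¹ * Polynomial.X), A, A', fun η => ?_, fun η x => ?_,
    hAc, hA'c, hA0, hA0d, fun η hη r hr => ?_⟩
  · refine natDegree_comp_le.trans (le_trans ?_ hpdeg)
    calc p.natDegree * (Polynomial.C η⁻¹ * Polynomial.X).natDegree ≤ p.natDegree * 1 :=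
          Nat.mul_le_mul_left _ (natDegree_C_mul_le _ _ |>.trans natDegree_X_le)
      _ = p.natDegree := mul_one _
  · simp only [eval_comp, eval_mul, eval_C, eval_X, mul_neg, hpodd]
  have hη0 := hη.1
  set P := p.comp (Polynomial.C η⁻¹ * Polynomial.X) with hP
  have hPe : ∀ x, P.eval x = p.eval (η⁻¹ * x) := fun x => by simp [hP]
  have hmem : η * r ∈ Ioo (0 : ℝ) 1 :=
    ⟨mul_pos hη0 hr.1, by nlinarith [hη.1, hη.2, hr.1, hr.2]⟩
  have hmem' : η * r ∈ Ioo (-1 : ℝ) 1 := ⟨by linarith [hmem.1], hmem.2⟩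
  have hcancel : ∀ ψ, η⁻¹ * sineChart a (η * r * Real.cos ψ) =
      r * Real.cos ψ * dslope (sineChart a) 0 (η * (r * Real.cos ψ)) := fun ψ => by
    rw [mul_assoc η, ← hDs (η * (r * Real.cos ψ))]
    field_simp
  constructor
  · have e := integral_mul_cos_eq (continuousOn_levelFriction a P)
      (fun w hw => hasDerivAt_levelFriction a P hw) hmem'
    refine Eq.trans (intervalIntegral.integral_congr fun ψ _ => ?_) e
    simp only [hPe, hcancel]
  · change A' (η, r) = η * circleMean _ (levelFriction a P) (η * r)
    rw [circleMean, ← intervalIntegral.integral_const_mul]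
    refine intervalIntegral.integral_congr fun ψ _ => ?_
    have hm : η * (r * Real.cos ψ) ∈ Icc (-(1 / 2) : ℝ) (1 / 2) := by
      rw [← mul_assoc]
      refine mul_cos_mem_Icc hmem.1.le ?_ ψ
      nlinarith [hr.1, hr.2, hη.1, hη.2]
    have hP' : ∀ x, (derivative P).eval x = η⁻¹ * (derivative p).eval (η⁻¹ * x) := fun x => by
      simp [hP, derivative_comp]
    simp only [levelFriction, hP', hcancel]
    simp only [hs' _ hm, mul_assoc η r]
    field_simp

lemma exists_polynomial_simple_roots (d : ℕ) :
    ∃ (Q : Polynomial ℝ) (Y : Finset ℝ), Q.natDegree = d ∧ Y.card = d ∧ ∀ y ∈ Y,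
      y ∈ Ioo (0 : ℝ) 1 ∧ Q.eval (y ^ 2) = 0 ∧ (derivative Q).eval (y ^ 2) ≠ 0 := by
  obtain ⟨Y, hY, hYd⟩ := (Set.Ioo_infinite (zero_lt_one (α := ℝ))).exists_subset_card_eq d
  refine ⟨Lagrange.nodal Y fun y => y ^ 2, Y, ?_, hYd, fun y hy => ⟨hY hy, ?_, ?_⟩⟩
  · rw [Lagrange.natDegree_nodal, hYd]
  · exact Lagrange.eval_nodal_at_node (v := fun y : ℝ => y ^ 2) hy
  · rw [Lagrange.eval_nodal_derivative_eval_node_eq (v := fun y : ℝ => y ^ 2) hy,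
      Lagrange.eval_nodal, Finset.prod_ne_zero_iff]
    intro x hx h
    exact (Finset.mem_erase.1 hx).1
      ((pow_left_inj₀ (hY hy).1.le (hY (Finset.mem_of_mem_erase hx)).1.le two_ne_zero).1
        (sub_eq_zero.1 h)).symm

/-- For fixed `a > 0` there are odd polynomials of degree at most `2 d + 1` whose averaged friction
has `d` simple zeros. -/
lemma exists_levelFriction_zeros {a : ℝ} (ha : 0 < a) (d : ℕ) :
    ∃ (P : Polynomial ℝ) (Z : Finset ℝ), P.natDegree ≤ 2 * d + 1 ∧
      (∀ v, P.eval (-v) = -P.eval v) ∧ Z.card = d ∧ ∀ ρ ∈ Z, ρ ∈ Ioo (0 : ℝ) 1 ∧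
        circleMean (fun ψ => Real.sin ψ ^ 2) (levelFriction a P) ρ = 0 ∧
        circleMean (fun ψ => Real.cos ψ ^ 2) (levelFriction a P) ρ ≠ 0 := by
  obtain ⟨Q, Y, hQdeg, hYd, hY⟩ := exists_polynomial_simple_roots d
  obtain ⟨P, A, A', hPdeg, hPodd, hAc, hA'c, hA0, hA0d, hAη⟩ := exists_rescaled_family ha Q
  rw [hQdeg] at hPdeg
  have hroot : ∀ y ∈ Y, A (0, y) = 0 ∧ A' (0, y) ≠ 0 := by
    intro y hy
    obtain ⟨hy01, hQy, hQ'y⟩ := hY y hy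
    refine ⟨by rw [hA0, hQy, mul_zero], ?_⟩
    have d := hasDerivAt_mul_eval_sq Q y
    simp only [← hA0] at d
    rw [(hA0d _ hy01).unique d, hQy]
    have hy0 := hy01.1.ne'
    rw [mul_zero, zero_add]
    exact mul_ne_zero hy0 (mul_ne_zero hQ'y (mul_ne_zero two_ne_zero hy0))
  obtain ⟨V, hV, hVd⟩ := Y.finite_toSet.t2_separation
  have hev : ∀ᶠ η in 𝓝[>] (0 : ℝ), ∀ y ∈ Y, ∃ r ∈ V y ∩ Ioo 0 1,
      A (η, r) = 0 ∧ A' (η, r) ≠ 0 := by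
    refine Filter.Eventually.filter_mono nhdsWithin_le_nhds ?_
    rw [Filter.eventually_all_finset]
    intro y hy
    have hm := (hY y hy).1
    exact eventually_exists_simple_zero isOpen_Ioo hm hAc.continuousOn hA'c.continuousOn
      (hroot y hy).1 (hA0d _ hm) (hroot y hy).2
      (inter_mem ((hV _).2.mem_nhds (hV _).1) (isOpen_Ioo.mem_nhds hm))
  have hhalf : ∀ᶠ η in 𝓝[>] (0 : ℝ), η < 1 / 2 :=
    Filter.Eventually.filter_mono nhdsWithin_le_nhds (gt_mem_nhds (by norm_num))
  obtain ⟨η, ⟨hη, hη2⟩, hηpos⟩ := ((hev.and hhalf).and self_mem_nhdsWithin).exists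
  have hη0 : 0 < η := hηpos
  choose! r hr hr1 hr2 using hη
  have hmem : ∀ y ∈ Y, η * r y ∈ Ioo (0 : ℝ) 1 := fun y hy => by
    have := (hr y hy).2
    exact ⟨mul_pos hη0 this.1, by nlinarith [this.1, this.2]⟩
  refine ⟨P η, Y.image fun y => η * r y, hPdeg η, hPodd η, ?_, ?_⟩
  · rw [Finset.card_image_of_injOn, hYd]
    intro y hy y' hy' h
    have hrr : r y = r y' := mul_left_cancel₀ hη0.ne' h
    by_contra hne
    refine Set.disjoint_left.1 (hVd hy hy' hne) (hr y hy).1 ?_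
    rw [hrr]
    exact (hr y' hy').1
  · intro ρ hρ
    obtain ⟨y, hy, rfl⟩ := Finset.mem_image.1 hρ
    obtain ⟨e1, e2⟩ := hAη η ⟨hη0, hη2⟩ (r y) (hr y hy).2
    rw [hr1 y hy] at e1
    refine ⟨hmem y hy, (mul_eq_zero.1 e1.symm).resolve_left (hmem y hy).1.ne', fun h => ?_⟩
    rw [h, mul_zero] at e2
    exact hr2 y hy e2

lemma circleMean_triangular {k : ℝ → ℝ} (hk : Continuous k) {b : ℕ → ℝ → ℝ} {N j : ℕ}
    (hj : j < N) (hb : ∀ l < N, ContinuousOn (b l) (Ioo (-1) 1))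
    {ρ : ℝ} (hρ : ρ ∈ Ioo (-1 : ℝ) 1)
    (h0 : ∀ l < N, j < l → circleMean k (b l) ρ = 0) (δ : ℝ) :
    circleMean k (fun w => ∑ l ∈ Finset.range N, δ ^ (N - l) * b l w) ρ =
      δ ^ (N - j) * ∑ l ∈ Finset.range (j + 1), δ ^ (j - l) * circleMean k (b l) ρ := by
  rw [circleMean_sum (Finset.range N) hk (fun l => δ ^ (N - l))
    (fun l hl => hb l (Finset.mem_range.1 hl)) (fun w _ => rfl) hρ, Finset.mul_sum]
  have hsub : Finset.range (j + 1) ⊆ Finset.range N := Finset.range_subset_range.2 hj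
  rw [← Finset.sum_subset hsub]
  · refine Finset.sum_congr rfl fun l hl => ?_
    have := Finset.mem_range.1 hl
    rw [← mul_assoc, ← pow_add]
    congr 2
    omega
  · intro l hl hl'
    rw [h0 l (Finset.mem_range.1 hl) (by simpa using hl'), mul_zero]

/-- Among frictions of increasing size, the largest one with nonzero averages determines the simple
zeros of the averaged sum. -/
lemma eventually_exists_zero_of_triangular {b Φ : ℕ → ℝ → ℝ} {N j : ℕ} (hj : j < N)
    (hb : ∀ l < N, ContinuousOn (b l) (Ioo (-1) 1))
    (hΦ : ∀ l < N, ∀ w ∈ Ioo (-1 : ℝ) 1, HasDerivAt (Φ l) (b l w) w)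
    (hodd : ∀ l < N, j < l → ∀ w ∈ Ioo (-1 : ℝ) 1, b l (-w) = -b l w)
    {ρ₀ : ℝ} (hρ₀ : ρ₀ ∈ Ioo (0 : ℝ) 1)
    (h0 : circleMean (fun ψ => Real.sin ψ ^ 2) (b j) ρ₀ = 0)
    (h1 : circleMean (fun ψ => Real.cos ψ ^ 2) (b j) ρ₀ ≠ 0) {V : Set ℝ} (hV : V ∈ 𝓝 ρ₀) :
    ∀ᶠ δ in 𝓝[>] (0 : ℝ), ∃ r ∈ V ∩ Ioo 0 1,
      circleMean (fun ψ => Real.sin ψ ^ 2)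
        (fun w => ∑ l ∈ Finset.range N, δ ^ (N - l) * b l w) r = 0 ∧
      circleMean (fun ψ => Real.cos ψ ^ 2)
        (fun w => ∑ l ∈ Finset.range N, δ ^ (N - l) * b l w) r ≠ 0 := by
  have hsub : Ioo (0 : ℝ) 1 ⊆ Ioo (-1) 1 := Ioo_subset_Ioo_left (by norm_num)
  have hbj : ∀ l ∈ Finset.range (j + 1), ContinuousOn (b l) (Ioo (-1) 1) := fun l hl =>
    hb l (by have := Finset.mem_range.1 hl; omega)
  have hks : Continuous fun ψ : ℝ => Real.sin ψ ^ 2 := by fun_prop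
  have hkc : Continuous fun ψ : ℝ => Real.cos ψ ^ 2 := by fun_prop
  have hcont : ∀ k : ℝ → ℝ, Continuous k → ContinuousOn (fun x : ℝ × ℝ =>
      ∑ l ∈ Finset.range (j + 1), x.1 ^ (j - l) * circleMean k (b l) x.2)
      (univ ×ˢ Ioo (0 : ℝ) 1) := by
    intro k hk
    refine continuousOn_finsetSum _ fun l hl => ContinuousOn.mul (by fun_prop) ?_
    exact (continuousOn_circleMean hk (hbj l hl)).comp continuousOn_snd fun x hx => hsub hx.2
  have hzero : ∀ k : ℝ → ℝ, ∀ r, (∑ l ∈ Finset.range (j + 1),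
      (0 : ℝ) ^ (j - l) * circleMean k (b l) r) = circleMean k (b j) r := by
    intro k r
    rw [Finset.sum_range_succ, Finset.sum_eq_zero, Nat.sub_self, pow_zero, one_mul, zero_add]
    intro l hl
    have := Finset.mem_range.1 hl
    rw [zero_pow (by omega), zero_mul]
  have hd := hasDerivAt_circleMean (hb j hj) (hΦ j hj) (hsub hρ₀)
  have key := eventually_exists_simple_zero
    (A := fun x => x.2 * ∑ l ∈ Finset.range (j + 1),
      x.1 ^ (j - l) * circleMean (fun ψ => Real.sin ψ ^ 2) (b l) x.2)
    (A' := fun x => ∑ l ∈ Finset.range (j + 1),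
      x.1 ^ (j - l) * circleMean (fun ψ => Real.cos ψ ^ 2) (b l) x.2)
    isOpen_Ioo hρ₀ (continuousOn_snd.mul (hcont _ hks)) (hcont _ hkc)
    (by simp only [hzero, h0, mul_zero]) (by simp only [hzero]; exact hd)
    (by simp only [hzero]; exact h1) (inter_mem hV (isOpen_Ioo.mem_nhds hρ₀))
  filter_upwards [nhdsWithin_le_nhds key, self_mem_nhdsWithin] with δ ⟨r, hr, hr0, hr1⟩ hδ
  have hδ0 : δ ≠ 0 := (mem_Ioi.1 hδ).ne'
  have hz : ∀ k : ℝ → ℝ, Continuous k → (∀ ψ, k (ψ + Real.pi) = k ψ) →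
      ∀ l < N, j < l → circleMean k (b l) r = 0 := fun k hk hkp l hl hjl =>
    circleMean_eq_zero_of_odd hk hkp (hb l hl) (hodd l hl hjl) (hsub hr.2)
  refine ⟨r, hr, ?_, ?_⟩
  · rw [circleMean_triangular hks hj hb (hsub hr.2) (hz _ hks fun ψ => by simp) δ,
      (mul_eq_zero.1 hr0).resolve_left hr.2.1.ne', mul_zero]
  · rw [circleMean_triangular hkc hj hb (hsub hr.2) (hz _ hkc fun ψ => by simp) δ]
    exact mul_ne_zero (pow_ne_zero _ hδ0) hr1

/-- The friction coefficient in a well chart of the polynomial friction `F'`. -/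
noncomputable def wellFriction (θ a : ℝ) (F : Polynomial ℝ) (w : ℝ) : ℝ :=
  (derivative F).eval (chartX θ a w) * chartX' θ a w

lemma hasDerivAt_wellFriction (θ a : ℝ) (F : Polynomial ℝ) {w : ℝ} (hw : w ∈ Ioo (-1 : ℝ) 1) :
    HasDerivAt (fun w => F.eval (chartX θ a w)) (wellFriction θ a F w) w :=
  HasDerivAt.comp (h₂ := fun x => F.eval x) w (F.hasDerivAt _) (hasDerivAt_chartX θ a hw)

lemma continuousOn_wellFriction (θ a : ℝ) (F : Polynomial ℝ) :
    ContinuousOn (wellFriction θ a F) (Ioo (-1) 1) :=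
  ((derivative F).continuous.comp_continuousOn fun _ hw =>
    (hasDerivAt_chartX θ a hw).continuousAt.continuousWithinAt).mul
    fun _ hw => (contDiffAt_chartX' θ a hw).continuousAt.continuousWithinAt

lemma wellFriction_sum {ι : Type*} (s : Finset ι) (c : ι → ℝ) (F : ι → Polynomial ℝ) (θ a w : ℝ) :
    wellFriction θ a (∑ i ∈ s, Polynomial.C (c i) * F i) w =
      ∑ i ∈ s, c i * wellFriction θ a (F i) w := by
  simp only [wellFriction, derivative_sum, derivative_C_mul, eval_finsetSum, eval_mul, eval_C,
    Finset.sum_mul, mul_assoc]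

lemma wellFriction_neg {θ a : ℝ} {F : Polynomial ℝ}
    (h : ∀ w, F.eval (chartX θ a (-w)) = F.eval (chartX θ a w)) {w : ℝ}
    (hw : w ∈ Ioo (-1 : ℝ) 1) : wellFriction θ a F (-w) = -wellFriction θ a F w := by
  have hw' : -w ∈ Ioo (-1 : ℝ) 1 := ⟨by linarith [hw.2], by linarith [hw.1]⟩
  have d := HasDerivAt.comp (h₂ := fun w => F.eval (chartX θ a w)) w
    (hasDerivAt_wellFriction θ a F hw') (hasDerivAt_neg w)
  have e : ((fun w => F.eval (chartX θ a w)) ∘ fun w => -w) =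
    fun w => F.eval (chartX θ a w) := funext h
  have := (hasDerivAt_wellFriction θ a F hw).unique (e ▸ d)
  linarith

lemma wellFriction_eq_levelFriction {θ a a' s : ℝ} {F P : Polynomial ℝ}
    (h : ∀ w, F.eval (chartX θ a w) = s * P.eval (sineChart a' w)) {w : ℝ}
    (hw : w ∈ Ioo (-1 : ℝ) 1) : wellFriction θ a F w = s * levelFriction a' P w := by
  have d := (hasDerivAt_levelFriction a' P hw).const_mul s
  exact (hasDerivAt_wellFriction θ a F hw).unique (by simpa only [h] using d)

lemma eval_T_two_pow_chartX (l : ℕ) (θ a w : ℝ) :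
    (Polynomial.Chebyshev.T ℝ ((2 ^ l : ℕ) : ℤ)).eval (chartX θ a w) =
      Real.cos (2 ^ l * θ - 2 ^ l * a * Real.arcsin w) := by
  rw [chartX, Polynomial.Chebyshev.T_real_cos]
  congr 1
  push_cast
  ring

/-- The wells of the Chebyshev potential are centred at `cos (wellAngle N k)`. -/
noncomputable def wellAngle (N k : ℕ) : ℝ := k * Real.pi / 2 ^ N

/-- The position of the `i`-th well of level `j`. -/
def wellIndex (N j i : ℕ) : ℕ := 2 ^ (N - 1 - j) * (2 * i + 1)

lemma wellIndex_injective {N j j' i i' : ℕ} (hj : j < N) (hj' : j' < N)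
    (h : wellIndex N j i = wellIndex N j' i') : j = j' ∧ i = i' := by
  have key : ∀ u v i i' : ℕ, u ≤ v → 2 ^ u * (2 * i + 1) = 2 ^ v * (2 * i' + 1) →
      u = v ∧ i = i' := by
    intro u v i i' huv h
    obtain ⟨t, rfl⟩ := Nat.exists_eq_add_of_le huv
    rw [pow_add, mul_assoc] at h
    have h' := Nat.eq_of_mul_eq_mul_left (by positivity) h
    rcases t with _ | t
    · omega
    · rw [pow_succ, mul_assoc, mul_left_comm] at h'
      omega
  rw [wellIndex, wellIndex] at h
  rcases le_total (N - 1 - j) (N - 1 - j') with hle | hle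
  · have := key _ _ _ _ hle h
    omega
  · have := key _ _ _ _ hle h.symm
    omega

lemma wellIndex_pos (N j i : ℕ) : 0 < wellIndex N j i := by
  rw [wellIndex]
  positivity

lemma wellIndex_lt {N j i : ℕ} (hj : j < N) (hi : i < 2 ^ j) : wellIndex N j i < 2 ^ N := by
  have : 2 ^ N = 2 ^ (N - 1 - j) * (2 * 2 ^ j) := by
    rw [← pow_succ', ← pow_add]
    congr 1
    omega
  rw [wellIndex, this]
  exact Nat.mul_lt_mul_of_pos_left (by omega) (by positivity)

lemma two_pow_mul_wellAngle {N j i : ℕ} (hj : j < N) :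
    2 ^ j * wellAngle N (wellIndex N j i) = i * Real.pi + Real.pi / 2 := by
  have : (2 : ℝ) ^ N = 2 ^ (N - 1 - j) * (2 * 2 ^ j) := by
    rw [← pow_succ', ← pow_add]
    congr 1
    omega
  rw [wellAngle, wellIndex, this]
  push_cast
  field_simp

lemma disjoint_chartDomain {N k k' : ℕ} (h : k ≠ k') :
    Disjoint (chartDomain (wellAngle N k) (1 / 2 ^ N)) (chartDomain (wellAngle N k') (1 / 2 ^ N)) := by
  rw [Set.disjoint_left]
  rintro x ⟨-, hx⟩ ⟨-, hx'⟩
  rw [Set.mem_ofPred_eq] at hx hx'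
  have h1 : |wellAngle N k - wellAngle N k'| < Real.pi / 2 ^ N := by
    have := abs_sub_le (wellAngle N k) (Real.arccos x) (wellAngle N k')
    rw [abs_sub_comm (Real.arccos x)] at this
    calc _ ≤ _ := this
      _ < _ := add_lt_add hx hx'
      _ = _ := by ring
  have h2 : wellAngle N k - wellAngle N k' = ((k : ℝ) - k') * (Real.pi / 2 ^ N) := by
    rw [wellAngle, wellAngle]
    ring
  have hp : 0 < Real.pi / 2 ^ N := by positivity
  rw [h2, abs_mul, abs_of_pos hp] at h1
  have h3 : |(k : ℝ) - k'| < 1 := by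
    by_contra hc
    nlinarith [not_lt.1 hc]
  have h4 : |(k : ℤ) - k'| < 1 := by exact_mod_cast h3
  rw [Int.abs_lt_one_iff] at h4
  omega

/-- The potential of the Hamiltonian part. -/
noncomputable def chebPotential (N : ℕ) : Polynomial ℝ :=
  Polynomial.C (-(1 / 4)) * Polynomial.Chebyshev.T ℝ ((2 ^ (N + 1) : ℕ) : ℤ)

lemma natDegree_derivative_chebPotential_le (N : ℕ) :
    (derivative (chebPotential N)).natDegree ≤ 2 ^ (N + 1) - 1 := by
  refine (natDegree_derivative_le _).trans (Nat.sub_le_sub_right ?_ 1)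
  refine (natDegree_C_mul_le _ _).trans ?_
  rw [Polynomial.Chebyshev.natDegree_T, Int.natAbs_natCast]

lemma wellChart_wellAngle (f : Polynomial ℝ) {N k : ℕ} (hk : 0 < k) (hk' : k < 2 ^ N) :
    WellChart f (derivative (chebPotential N)) (chartDomain (wellAngle N k) (1 / 2 ^ N))
      (chartX (wellAngle N k) (1 / 2 ^ N)) (chartX' (wellAngle N k) (1 / 2 ^ N))
      (fun x => Real.sin ((wellAngle N k - Real.arccos x) / (1 / 2 ^ N)))
      (fun w => f.eval (chartX (wellAngle N k) (1 / 2 ^ N) w) *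
        chartX' (wellAngle N k) (1 / 2 ^ N) w) := by
  have hp : 0 < Real.pi / 2 ^ N := by positivity
  have e : wellAngle N k = k * (Real.pi / 2 ^ N) := by rw [wellAngle]; ring
  have hk1 : (1 : ℝ) ≤ k := by exact_mod_cast hk
  have hk2 : (k : ℝ) + 1 ≤ 2 ^ N := by exact_mod_cast hk'
  refine wellChart_cos (by positivity) ?_ ?_ fun φ => ?_
  · rw [e]
    have : 1 / 2 ^ N * (Real.pi / 2) = 1 / 2 * (Real.pi / 2 ^ N) := by ring
    rw [this]
    nlinarith
  · rw [e]
    have h1 : 1 / 2 ^ N * (Real.pi / 2) = 1 / 2 * (Real.pi / 2 ^ N) := by ring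
    have h2 : Real.pi = 2 ^ N * (Real.pi / 2 ^ N) := by field_simp
    rw [h1]
    calc _ < 2 ^ N * (Real.pi / 2 ^ N) := by nlinarith
      _ = Real.pi := h2.symm
  · rw [chebPotential, eval_mul, eval_C, Polynomial.Chebyshev.T_real_cos,
      ← Real.cos_nat_mul_two_pi_sub (2 * φ) k]
    congr 2
    rw [wellAngle]
    push_cast
    field_simp
    ring

lemma eval_neg_one_pow_mul {P : Polynomial ℝ} (hP : ∀ v, P.eval (-v) = -P.eval v) (i : ℕ) (v : ℝ) :
    P.eval ((-1) ^ i * v) = (-1) ^ i * P.eval v := by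
  rcases neg_one_pow_eq_or ℝ i with h | h <;> simp [h, hP]

lemma eval_comp_T_chartX_eq {N j i : ℕ} (hj : j < N) {P : Polynomial ℝ}
    (hP : ∀ v, P.eval (-v) = -P.eval v) (w : ℝ) :
    (P.comp (Polynomial.Chebyshev.T ℝ ((2 ^ j : ℕ) : ℤ))).eval
        (chartX (wellAngle N (wellIndex N j i)) (1 / 2 ^ N) w) =
      (-1) ^ i * P.eval (sineChart (2 ^ j * (1 / 2 ^ N)) w) := by
  rw [eval_comp, eval_T_two_pow_chartX, two_pow_mul_wellAngle hj, add_sub_assoc, add_comm,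
    Real.cos_add_nat_mul_pi, Real.cos_pi_div_two_sub, eval_neg_one_pow_mul hP, sineChart]

lemma eval_comp_T_chartX_neg {N j l i : ℕ} (hj : j < N) (hl : j < l) (P : Polynomial ℝ) (w : ℝ) :
    (P.comp (Polynomial.Chebyshev.T ℝ ((2 ^ l : ℕ) : ℤ))).eval
        (chartX (wellAngle N (wellIndex N j i)) (1 / 2 ^ N) (-w)) =
      (P.comp (Polynomial.Chebyshev.T ℝ ((2 ^ l : ℕ) : ℤ))).eval
        (chartX (wellAngle N (wellIndex N j i)) (1 / 2 ^ N) w) := by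
  have e : 2 ^ l * wellAngle N (wellIndex N j i) =
      ((2 ^ (l - 1 - j) * (2 * i + 1) : ℕ) : ℝ) * Real.pi := by
    have : (2 : ℝ) ^ l = 2 ^ (l - 1 - j) * 2 * 2 ^ j := by
      rw [← pow_succ, ← pow_add]
      congr 1
      omega
    rw [this, mul_assoc, two_pow_mul_wellAngle hj]
    push_cast
    ring
  rw [eval_comp, eval_comp, eval_T_two_pow_chartX, eval_T_two_pow_chartX, e, Real.arcsin_neg,
    Real.cos_nat_mul_pi_sub, Real.cos_nat_mul_pi_sub, mul_neg, Real.cos_neg]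

/-- The primitive of the friction coefficient: a superposition of the level polynomials. -/
noncomputable def levelSum (N : ℕ) (P : ℕ → Polynomial ℝ) (δ : ℝ) : Polynomial ℝ :=
  ∑ l ∈ Finset.range N,
    Polynomial.C (δ ^ (N - l)) * (P l).comp (Polynomial.Chebyshev.T ℝ ((2 ^ l : ℕ) : ℤ))

lemma eventually_exists_zero_levelSum {N j : ℕ} (hj : j < N) (i : ℕ) {P : ℕ → Polynomial ℝ}
    (hP : ∀ l v, (P l).eval (-v) = -(P l).eval v) {ρ₀ : ℝ} (hρ₀ : ρ₀ ∈ Ioo (0 : ℝ) 1)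
    (h0 : circleMean (fun ψ => Real.sin ψ ^ 2) (levelFriction (2 ^ j * (1 / 2 ^ N)) (P j)) ρ₀ = 0)
    (h1 : circleMean (fun ψ => Real.cos ψ ^ 2) (levelFriction (2 ^ j * (1 / 2 ^ N)) (P j)) ρ₀ ≠ 0)
    {V : Set ℝ} (hV : V ∈ 𝓝 ρ₀) :
    ∀ᶠ δ in 𝓝[>] (0 : ℝ), ∃ r ∈ V ∩ Ioo 0 1,
      circleMean (fun ψ => Real.sin ψ ^ 2)
        (wellFriction (wellAngle N (wellIndex N j i)) (1 / 2 ^ N) (levelSum N P δ)) r = 0 ∧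
      circleMean (fun ψ => Real.cos ψ ^ 2)
        (wellFriction (wellAngle N (wellIndex N j i)) (1 / 2 ^ N) (levelSum N P δ)) r ≠ 0 := by
  set θ := wellAngle N (wellIndex N j i)
  set F : ℕ → Polynomial ℝ := fun l =>
    (P l).comp (Polynomial.Chebyshev.T ℝ ((2 ^ l : ℕ) : ℤ)) with hF
  have hρ : ρ₀ ∈ Ioo (-1 : ℝ) 1 := ⟨by linarith [hρ₀.1], hρ₀.2⟩
  have hlev : ∀ k : ℝ → ℝ, Continuous k → circleMean k (wellFriction θ (1 / 2 ^ N) (F j)) ρ₀ =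
      (-1) ^ i * circleMean k (levelFriction (2 ^ j * (1 / 2 ^ N)) (P j)) ρ₀ := by
    intro k hk
    have := circleMean_sum {()} hk (fun _ => (-1 : ℝ) ^ i)
      (fun _ _ => continuousOn_levelFriction (2 ^ j * (1 / 2 ^ N)) (P j))
      (B := wellFriction θ (1 / 2 ^ N) (F j)) (fun w hw => by
        rw [Finset.sum_singleton]
        exact wellFriction_eq_levelFriction (eval_comp_T_chartX_eq hj (hP j)) hw) hρ
    rwa [Finset.sum_singleton] at this
  have e : ∀ δ, wellFriction θ (1 / 2 ^ N) (levelSum N P δ) = fun w =>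
      ∑ l ∈ Finset.range N, δ ^ (N - l) * wellFriction θ (1 / 2 ^ N) (F l) w := fun δ =>
    funext fun w => wellFriction_sum _ _ _ _ _ _
  simp only [e]
  refine eventually_exists_zero_of_triangular (b := fun l => wellFriction θ (1 / 2 ^ N) (F l)) hj
    (fun l _ => continuousOn_wellFriction _ _ _) (fun l _ w hw => hasDerivAt_wellFriction _ _ _ hw)
    (fun l _ hjl w hw => wellFriction_neg (eval_comp_T_chartX_neg hj hjl (P l)) hw) hρ₀
    ?_ ?_ hV
  · rw [hlev _ (by fun_prop), h0, mul_zero]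
  · rw [hlev _ (by fun_prop)]
    exact mul_ne_zero (pow_ne_zero _ (by norm_num)) h1

lemma natDegree_levelSum_le {N M : ℕ} {P : ℕ → Polynomial ℝ}
    (h : ∀ l < N, (P l).natDegree * 2 ^ l ≤ M) (δ : ℝ) : (levelSum N P δ).natDegree ≤ M := by
  refine natDegree_sum_le_of_forall_le _ _ fun l hl => ?_
  refine (natDegree_C_mul_le _ _).trans (natDegree_comp_le.trans ?_)
  rw [Polynomial.Chebyshev.natDegree_T, Int.natAbs_natCast]
  exact h l (Finset.mem_range.1 hl)

lemma IsLimitCycle.nonempty {V : ℝ × ℝ → ℝ × ℝ} {Γ : Set (ℝ × ℝ)} (h : IsLimitCycle V Γ) :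
    Γ.Nonempty := by
  obtain ⟨⟨γ, -, -, -, rfl⟩, -⟩ := h
  exact Set.range_nonempty γ

lemma HGe_of_levels {N μ : ℕ} (hN : 2 ^ (N + 1) ≤ μ + 1) (d : ℕ → ℕ)
    (hd : ∀ j < N, (2 * d j + 1) * 2 ^ j ≤ μ + 1) :
    HGe μ μ ((∑ j ∈ Finset.range N, 2 ^ j * d j : ℕ) : ℝ) := by
  have hex := fun j : ℕ =>
    exists_levelFriction_zeros (a := 2 ^ j * (1 / 2 ^ N)) (by positivity) (d j)
  choose P Z hPdeg hPodd hZcard hZ using hex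
  have hsep := fun j => (Z j).finite_toSet.t2_separation
  choose V hV hVd using hsep
  set K : Finset (Σ _ : ℕ, ℕ × ℝ) :=
    (Finset.range N).sigma fun j => Finset.range (2 ^ j) ×ˢ Z j with hK
  have hKcard : K.card = ∑ j ∈ Finset.range N, 2 ^ j * d j := by
    simp only [hK, Finset.card_sigma, Finset.card_product, Finset.card_range, hZcard]
  have hKmem : ∀ q ∈ K, q.1 < N ∧ q.2.1 < 2 ^ q.1 ∧ q.2.2 ∈ Z q.1 := fun q hq => by
    simpa [hK] using hq
  set θ : (Σ _ : ℕ, ℕ × ℝ) → ℝ := fun q => wellAngle N (wellIndex N q.1 q.2.1) with hθ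
  have hδ : ∀ᶠ δ in 𝓝[>] (0 : ℝ), ∀ q ∈ K, ∃ r ∈ V q.1 q.2.2 ∩ Ioo 0 1,
      circleMean (fun ψ => Real.sin ψ ^ 2)
        (wellFriction (θ q) (1 / 2 ^ N) (levelSum N P δ)) r = 0 ∧
      circleMean (fun ψ => Real.cos ψ ^ 2)
        (wellFriction (θ q) (1 / 2 ^ N) (levelSum N P δ)) r ≠ 0 := by
    rw [Filter.eventually_all_finset]
    intro q hq
    obtain ⟨hq1, -, hq3⟩ := hKmem q hq
    obtain ⟨hm, h0, h1⟩ := hZ q.1 q.2.2 hq3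
    exact eventually_exists_zero_levelSum hq1 q.2.1 hPodd hm h0 h1
      ((hV q.1 q.2.2).2.mem_nhds (hV q.1 q.2.2).1)
  obtain ⟨δ, hδ⟩ := hδ.exists
  choose! r hr hr0 hr1 using hδ
  set f := derivative (levelSum N P δ) with hf
  have hev : ∀ᶠ ε in 𝓝[>] (0 : ℝ), ∀ q ∈ K, ∃ Γ,
      IsLimitCycle (lienard f (derivative (chebPotential N)) ε) Γ ∧
      Γ ⊆ {p | p.1 ∈ chartDomain (θ q) (1 / 2 ^ N) ∧
        √(Real.sin ((θ q - Real.arccos p.1) / (1 / 2 ^ N)) ^ 2 + p.2 ^ 2) ∈ V q.1 q.2.2} := by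
    rw [Filter.eventually_all_finset]
    intro q hq
    obtain ⟨hq1, hq2, -⟩ := hKmem q hq
    exact (wellChart_wellAngle f (wellIndex_pos _ _ _) (wellIndex_lt hq1 hq2)).exists_isLimitCycle
      (hr q hq).2 (hr0 q hq) (hr1 q hq) ((hV q.1 q.2.2).2.mem_nhds (hr q hq).1)
  obtain ⟨ε₀, hε₀, hε⟩ := mem_nhdsGT_iff_exists_Ioc_subset.1 hev
  refine ⟨f, derivative (chebPotential N), ?_, ?_, ε₀, hε₀, fun ε hε1 hε2 => ?_⟩
  · refine (natDegree_derivative_le _).trans (Nat.sub_le_of_le_add ?_)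
    exact natDegree_levelSum_le
      (fun l hl => (Nat.mul_le_mul_right _ (hPdeg l)).trans (hd l hl)) δ
  · exact (natDegree_derivative_chebPotential_le N).trans (Nat.sub_le_of_le_add hN)
  · have hΓ := hε ⟨hε1, hε2⟩
    rw [Set.mem_ofPred_eq] at hΓ
    choose! Γ hΓ hΓsub using hΓ
    refine ⟨K.image Γ, fun Δ hΔ => ?_, ?_⟩
    · obtain ⟨q, hq, rfl⟩ := Finset.mem_image.1 hΔ
      exact hΓ q hq
    · rw [Finset.card_image_of_injOn, hKcard]
      intro q hq q' hq' h
      obtain ⟨hq1, -, hq3⟩ := hKmem q hq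
      obtain ⟨hq1', -, hq3'⟩ := hKmem q' hq'
      obtain ⟨p, hp⟩ := (hΓ q hq).nonempty
      obtain ⟨hpd, hpV⟩ := hΓsub q hq hp
      have hp' : p ∈ Γ q' := by
        rwa [← h]
      obtain ⟨hpd', hpV'⟩ := hΓsub q' hq' hp'
      have hk : wellIndex N q.1 q.2.1 = wellIndex N q'.1 q'.2.1 := by
        by_contra hne
        exact Set.disjoint_left.1 (disjoint_chartDomain hne) hpd hpd'
      obtain ⟨h1, h2⟩ := wellIndex_injective hq1 hq1' hk
      obtain ⟨j, i, ρ⟩ := q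
      obtain ⟨j', i', ρ'⟩ := q'
      obtain rfl : j = j' := h1
      obtain rfl : i = i' := h2
      have : ρ = ρ' := by
        by_contra hne
        exact Set.disjoint_left.1 (hVd j hq3 hq3' hne) hpV hpV'
      rw [this]

lemma HGe.mono {n n' m m' : ℕ} {c c' : ℝ} (h : HGe n m c) (hn : n ≤ n') (hm : m ≤ m')
    (hc : c' ≤ c) : HGe n' m' c' := by
  obtain ⟨f, g, hf, hg, ε₀, hε₀, H⟩ := h
  refine ⟨f, g, hf.trans hn, hg.trans hm, ε₀, hε₀, fun ε h1 h2 => ?_⟩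
  obtain ⟨S, hS, hcard⟩ := H ε h1 h2
  exact ⟨S, hS, hc.trans hcard⟩

lemma HGe_self {μ : ℕ} (hμ : 1 ≤ μ) :
    HGe μ μ ((μ + 1 : ℝ) / 2 * (Real.log (μ + 1) / Real.log 2 - 4)) := by
  set N := Nat.log 2 (μ + 1) - 1 with hNdef
  have hlog : 1 ≤ Nat.log 2 (μ + 1) := Nat.log_pos (by norm_num) (by omega)
  have hN : 2 ^ (N + 1) ≤ μ + 1 := by
    rw [hNdef, Nat.sub_add_cancel hlog]
    exact Nat.pow_log_le_self 2 (by omega)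
  have hN' : μ + 1 < 2 ^ (N + 2) := by
    have := Nat.lt_pow_succ_log_self (b := 2) (by norm_num) (μ + 1)
    rwa [show N + 2 = (Nat.log 2 (μ + 1)).succ by omega]
  have hq : ∀ j < N, 1 ≤ (μ + 1) / 2 ^ j := fun j hj => by
    rw [Nat.one_le_div_iff (by positivity)]
    exact (Nat.pow_le_pow_right (by norm_num) (by omega)).trans hN
  refine (HGe_of_levels hN (fun j => ((μ + 1) / 2 ^ j - 1) / 2) fun j hj => ?_).mono
    le_rfl le_rfl ?_
  · have := hq j hj
    exact (Nat.mul_le_mul_right _ (by omega)).trans (Nat.div_mul_le_self (μ + 1) (2 ^ j))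
  · have hterm : ∀ j ∈ Finset.range N, (μ + 1 : ℝ) / 2 - 3 / 2 * 2 ^ j ≤
        ((2 ^ j * (((μ + 1) / 2 ^ j - 1) / 2) : ℕ) : ℝ) := fun j _ => by
      have h1 : (μ + 1) / 2 ^ j ≤ 2 * (((μ + 1) / 2 ^ j - 1) / 2) + 2 := by omega
      have h2 : μ + 1 ≤ 2 ^ j * ((μ + 1) / 2 ^ j) + 2 ^ j :=
        (Nat.lt_mul_div_succ (μ + 1) (by positivity : 0 < 2 ^ j)).le.trans_eq (by ring)
      have h3 : μ + 1 ≤ 2 * (2 ^ j * (((μ + 1) / 2 ^ j - 1) / 2)) + 3 * 2 ^ j := by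
        have := Nat.mul_le_mul_left (2 ^ j) h1
        linarith
      have h4 : (μ + 1 : ℝ) ≤
          2 * ((2 ^ j * (((μ + 1) / 2 ^ j - 1) / 2) : ℕ) : ℝ) + 3 * 2 ^ j := by exact_mod_cast h3
      linarith
    rw [Nat.cast_sum]
    refine le_trans ?_ (Finset.sum_le_sum hterm)
    rw [Finset.sum_sub_distrib, Finset.sum_const, Finset.card_range, ← Finset.mul_sum,
      geom_sum_eq (by norm_num), nsmul_eq_mul]
    have hNr : (2 : ℝ) * 2 ^ N ≤ μ + 1 := by
      rw [pow_succ'] at hN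
      exact_mod_cast hN
    have hl2 : 0 < Real.log 2 := Real.log_pos (by norm_num)
    have hNl : Real.log (μ + 1) / Real.log 2 ≤ N + 2 := by
      rw [div_le_iff₀ hl2]
      have h1 : (μ + 1 : ℝ) ≤ 2 ^ (N + 2) := by exact_mod_cast hN'.le
      have := Real.log_le_log (by positivity) h1
      rw [Real.log_pow] at this
      exact_mod_cast this
    have hμ0 : (0 : ℝ) < μ + 1 := by positivity
    nlinarith [mul_le_mul_of_nonneg_left hNl hμ0.le]

/-- Shifting the argument by a constant is negligible against any loss in the constant. -/
lemma exists_mul_log_add_le {c : ℝ} (hc0 : 0 ≤ c) (hc : c < 1 / (2 * Real.log 2)) {s : ℝ}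
    (hs : 0 ≤ s) : ∃ Y : ℝ, ∀ y, Y ≤ y → 1 ≤ y →
      c * (y + s) * Real.log (y + s) ≤ y / 2 * (Real.log y / Real.log 2 - 4) := by
  set κ := 1 / (2 * Real.log 2) - c with hκ
  have hκ0 : 0 < κ := sub_pos.2 hc
  refine ⟨Real.exp ((2 + c * (2 * s + s ^ 2)) / κ), fun y hY hy => ?_⟩
  have hy0 : 0 < y := by linarith
  have h1 : 2 + c * (2 * s + s ^ 2) ≤ κ * Real.log y := by
    have := (Real.le_log_iff_exp_le hy0).2 hY
    rwa [div_le_iff₀' hκ0] at this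
  have h2 : Real.log (y + s) ≤ Real.log y + s / y := by
    have e : y + s = y * (1 + s / y) := by field_simp
    have hpos : 0 < 1 + s / y := by positivity
    rw [e, Real.log_mul hy0.ne' hpos.ne']
    linarith [Real.log_le_sub_one_of_pos hpos]
  have h3 : Real.log y ≤ y := (Real.log_le_sub_one_of_pos hy0).trans (by linarith)
  have h4 : s / y * (y + s) ≤ s * y + s ^ 2 * y := by
    have : s / y * (y + s) = s + s ^ 2 / y := by field_simp
    rw [this]
    have h5 : s ^ 2 / y ≤ s ^ 2 * y := by
      rw [div_le_iff₀ hy0]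
      nlinarith [sq_nonneg s, mul_le_mul hy hy zero_le_one hy0.le]
    nlinarith
  have h6 : (y + s) * Real.log (y + s) ≤ y * Real.log y + y * (2 * s + s ^ 2) := by
    have := mul_le_mul_of_nonneg_left h2 (by positivity : 0 ≤ y + s)
    nlinarith [mul_le_mul_of_nonneg_left h3 hs]
  calc c * (y + s) * Real.log (y + s) ≤ c * (y * Real.log y + y * (2 * s + s ^ 2)) := by
        rw [mul_assoc]
        exact mul_le_mul_of_nonneg_left h6 hc0
    _ = y * (c * Real.log y + (2 + c * (2 * s + s ^ 2))) - 2 * y := by ring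
    _ ≤ y * (c * Real.log y + κ * Real.log y) - 2 * y := by
        have := mul_le_mul_of_nonneg_left h1 hy0.le
        linarith
    _ = y / 2 * (Real.log y / Real.log 2 - 4) := by
        rw [hκ]
        ring

theorem stmt12 (r : ℕ) (hr : 1 ≤ r) (c : ℝ) (hc : c < 1 / (2 * Real.log 2)) :
    ∃ M : ℕ, ∀ m : ℕ, M ≤ m → r < m →
      HGe (m + r) m (c * (m : ℝ) * Real.log (m : ℝ)) ∧
      HGe (m - r) m (c * (m : ℝ) * Real.log (m : ℝ)) := by
  have hl2 : 0 < Real.log 2 := Real.log_pos (by norm_num)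
  have hs : (0 : ℝ) ≤ r - 1 := by
    rw [sub_nonneg]
    exact_mod_cast hr
  obtain ⟨Y, hY⟩ := exists_mul_log_add_le (le_max_right c 0) (max_lt hc (by positivity)) hs
  refine ⟨r + ⌈Y⌉₊, fun m hm hrm => ?_⟩
  obtain ⟨μ, rfl⟩ := Nat.exists_eq_add_of_lt hrm
  have hYm : Y ≤ ((μ + 1 : ℕ) : ℝ) + 1 := by
    have : ⌈Y⌉₊ ≤ μ + 1 := by omega
    exact (Nat.ceil_le.1 this).trans (by linarith)
  have hbound : c * ((r + μ + 1 : ℕ) : ℝ) * Real.log ((r + μ + 1 : ℕ) : ℝ) ≤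
      (((μ + 1 : ℕ) : ℝ) + 1) / 2 * (Real.log (((μ + 1 : ℕ) : ℝ) + 1) / Real.log 2 - 4) := by
    have h1 := hY _ hYm (by linarith [(Nat.cast_nonneg (μ + 1) : (0 : ℝ) ≤ ((μ + 1 : ℕ) : ℝ))])
    have e : ((μ + 1 : ℕ) : ℝ) + 1 + (r - 1) = ((r + μ + 1 : ℕ) : ℝ) := by
      push_cast
      ring
    rw [e] at h1
    refine le_trans ?_ h1
    have hlog := Real.log_natCast_nonneg (r + μ + 1)
    gcongr
    exact le_max_left c 0
  have hH := HGe_self (μ := μ + 1) (by omega)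
  exact ⟨hH.mono (by omega) (by omega) hbound, hH.mono (by omega) (by omega) hbound⟩
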